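/- arXiv:1712.04169 — 6 statements merged into one kernel-verified Lean document; each statement's English description precedes it below -/
import Mathlib

section
/- Assume q > p. If A ⊆ Δ_n^+(𝔩) and C ⊆ Δ(𝔭_1) satisfy P_K(λ_0 − σ(A) − σ(C)) ≠ 0, then the vector Λ = λ_0 − σ(A) − σ(C) satisfies Λ_{2p−k+l} = q − l + 1 for every l = 1, …, q−p. -/
open Finset

/-- Product over a block `B` of indices of `(λ_i - λ_j)/(j - i)` over pairs `i < j` in `B`. -/
def blockProd (B : Finset ℕ) (lam : ℕ → ℚ) : ℚ :=
  ∏ i ∈ B, ∏ j ∈ B, if i < j then (lam i - lam j) / ((j : ℚ) - (i : ℚ)) else 1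

/-- The Weyl dimension polynomial `P_K` for `K = S(U(p) × U(q))`:
`P_K(λ) = ∏_{1≤i<j≤p} (λ_i−λ_j)/(j−i) · ∏_{p+1≤i<j≤p+q} (λ_i−λ_j)/(j−i)`. -/
def PK (p q : ℕ) (lam : ℕ → ℚ) : ℚ :=
  blockProd (Finset.Icc 1 p) lam * blockProd (Finset.Icc (p + 1) (p + q)) lam

/-- The Weyl dimension polynomial `P_{K∩L}`, a product over the five index blocks
`{1,…,k}`, `{k+1,…,p}`, `{p+1,…,2p−k}`, `{2p−k+1,…,p+q−k}`, `{p+q−k+1,…,p+q}`. -/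
def PKL (p q k : ℕ) (lam : ℕ → ℚ) : ℚ :=
  blockProd (Finset.Icc 1 k) lam * blockProd (Finset.Icc (k + 1) p) lam *
    blockProd (Finset.Icc (p + 1) (2 * p - k)) lam *
    blockProd (Finset.Icc (2 * p - k + 1) (p + q - k)) lam *
    blockProd (Finset.Icc (p + q - k + 1) (p + q)) lam

/-- The vector `e_i − e_j` in `ℚ^n` (indices written `1,…,n`). -/
def root (i j : ℕ) : ℕ → ℚ := fun t => (if t = i then (1 : ℚ) else 0) - (if t = j then 1 else 0)

/-- `σ(S) = ∑_{β ∈ S} β`, where the finite set `S` of vectors `e_i − e_j` is encoded by the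
finite set of the corresponding pairs `(i, j)`. -/
def sigmaSum (S : Finset (ℕ × ℕ)) : ℕ → ℚ := fun t => ∑ ij ∈ S, root ij.1 ij.2 t

/-- `Δ_n^+(𝔩) = {e_i − e_j : 1 ≤ i ≤ k, p+1 ≤ j ≤ 2p−k} ∪
{e_i − e_j : k+1 ≤ i ≤ p, p+q−k+1 ≤ j ≤ p+q}`, encoded by pairs of indices. -/
def DeltaNL (p q k : ℕ) : Finset (ℕ × ℕ) :=
  (Finset.Icc 1 k ×ˢ Finset.Icc (p + 1) (2 * p - k)) ∪
    (Finset.Icc (k + 1) p ×ˢ Finset.Icc (p + q - k + 1) (p + q))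

/-- `Δ(𝔭_1) = {e_i − e_j : 1 ≤ i ≤ k, 2p−k+1 ≤ j ≤ p+q−k} ∪
{e_i − e_j : 2p−k+1 ≤ i ≤ p+q−k, k+1 ≤ j ≤ p}`, encoded by pairs of indices. -/
def DeltaP1 (p q k : ℕ) : Finset (ℕ × ℕ) :=
  (Finset.Icc 1 k ×ˢ Finset.Icc (2 * p - k + 1) (p + q - k)) ∪
    (Finset.Icc (2 * p - k + 1) (p + q - k) ×ˢ Finset.Icc (k + 1) p)

/-- The special point
`λ_0 = (q, q−1, …, q−k+1, p, p−1, …, k+1 | p−k, …, 1, q−k, …, p−k+1, k, …, 1)`. -/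
def lam0 (p q k : ℕ) : ℕ → ℚ := fun t =>
  if t ≤ k then (q : ℚ) + 1 - t
  else if t ≤ p then (p : ℚ) + k + 1 - t
  else if t ≤ 2 * p - k then 2 * (p : ℚ) - k + 1 - t
  else if t ≤ p + q - k then (q : ℚ) + 2 * p - 2 * k + 1 - t
  else (p : ℚ) + q + 1 - t

/-- The alternating double sum
`∑_{A ⊆ Δ_n^+(𝔩)} ∑_{C ⊆ Δ(𝔭_1)} (−1)^{|A|+|C|} P_K(λ − σ(A) − σ(C))`. -/
def DSum (p q k : ℕ) (lam : ℕ → ℚ) : ℚ :=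
  ∑ A ∈ (DeltaNL p q k).powerset, ∑ C ∈ (DeltaP1 p q k).powerset,
    (-1 : ℚ) ^ (A.card + C.card) *
      PK p q (fun t => lam t - sigmaSum A t - sigmaSum C t)

theorem sigmaSum_eq_card_sub_card (S : Finset (ℕ × ℕ)) (t : ℕ) :
    sigmaSum S t = (#{x ∈ S | x.1 = t} : ℚ) - #{x ∈ S | x.2 = t} := by
  simp only [sigmaSum, root, Finset.sum_sub_distrib, Finset.sum_boole, eq_comm]

theorem blockProd_injOn {B : Finset ℕ} {lam : ℕ → ℚ} (h : blockProd B lam ≠ 0) :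
    Set.InjOn lam B := by
  have key : ∀ i ∈ B, ∀ j ∈ B, i < j → lam i ≠ lam j := by
    intro i hi j hj hij heq
    have h' := Finset.prod_ne_zero_iff.mp (Finset.prod_ne_zero_iff.mp h i hi) j hj
    simp [hij, heq] at h'
  intro i hi j hj heq
  rcases lt_trichotomy i j with hij | hij | hij
  · exact absurd heq (key i hi j hj hij)
  · exact hij
  · exact absurd heq.symm (key j hj i hi hij)

theorem card_fst_eq_le {S : Finset (ℕ × ℕ)} {t : ℕ} (B : Finset ℕ)
    (h : ∀ i j, (i, j) ∈ S → i = t → j ∈ B) : #{x ∈ S | x.1 = t} ≤ #B := by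
  refine Finset.card_le_card_of_injOn Prod.snd ?_ ?_
  · rintro ⟨i, j⟩ hx
    simp only [coe_filter, Set.mem_ofPred_eq] at hx
    exact h i j hx.1 hx.2
  · rintro ⟨i, j⟩ hx ⟨i', j'⟩ hy hxy
    simp only [coe_filter, Set.mem_ofPred_eq] at hx hy hxy
    simp [hx.2, hy.2, hxy]

theorem card_snd_eq_le {S : Finset (ℕ × ℕ)} {t : ℕ} (B : Finset ℕ)
    (h : ∀ i j, (i, j) ∈ S → j = t → i ∈ B) : #{x ∈ S | x.2 = t} ≤ #B := by
  refine Finset.card_le_card_of_injOn Prod.fst ?_ ?_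
  · rintro ⟨i, j⟩ hx
    simp only [coe_filter, Set.mem_ofPred_eq] at hx
    exact h i j hx.1 hx.2
  · rintro ⟨i, j⟩ hx ⟨i', j'⟩ hy hxy
    simp only [coe_filter, Set.mem_ofPred_eq] at hx hy hxy
    simp [hx.2, hy.2, hxy]

theorem mem_DeltaNL {p q k i j : ℕ} : (i, j) ∈ DeltaNL p q k ↔
    (1 ≤ i ∧ i ≤ k ∧ p + 1 ≤ j ∧ j ≤ 2 * p - k) ∨
      (k + 1 ≤ i ∧ i ≤ p ∧ p + q - k + 1 ≤ j ∧ j ≤ p + q) := by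
  simp [DeltaNL, and_assoc]

theorem mem_DeltaP1 {p q k i j : ℕ} : (i, j) ∈ DeltaP1 p q k ↔
    (1 ≤ i ∧ i ≤ k ∧ 2 * p - k + 1 ≤ j ∧ j ≤ p + q - k) ∨
      (2 * p - k + 1 ≤ i ∧ i ≤ p + q - k ∧ k + 1 ≤ j ∧ j ≤ p) := by
  simp [DeltaP1, and_assoc]

section Bounds

variable {p q k : ℕ} {A C : Finset (ℕ × ℕ)}

/-- On the outer part of the second block the shifted coordinates are integers in `[1, p]`. -/
theorem exists_int_mem_Icc_of_outer (hpq : p < q) (hk : k ≤ p)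
    (hA : A ⊆ DeltaNL p q k) (hC : C ⊆ DeltaP1 p q k) {t : ℕ}
    (ht : t ∈ Finset.Icc (p + 1) (2 * p - k) ∪ Finset.Icc (p + q - k + 1) (p + q)) :
    ∃ m : ℤ, lam0 p q k t - sigmaSum A t - sigmaSum C t = m ∧ 1 ≤ m ∧ m ≤ p := by
  have hA' := fun i j (h : (i, j) ∈ A) => mem_DeltaNL.mp (hA h)
  have hC' := fun i j (h : (i, j) ∈ C) => mem_DeltaP1.mp (hC h)
  simp only [mem_union, mem_Icc] at ht
  have h1 : #{x ∈ A | x.1 = t} ≤ #(∅ : Finset ℕ) := card_fst_eq_le _ fun i j h e => by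
    have := hA' i j h; omega
  have h2 : #{x ∈ C | x.1 = t} ≤ #(∅ : Finset ℕ) := card_fst_eq_le _ fun i j h e => by
    have := hC' i j h; omega
  have h3 : #{x ∈ C | x.2 = t} ≤ #(∅ : Finset ℕ) := card_snd_eq_le _ fun i j h e => by
    have := hC' i j h; omega
  simp only [card_empty, Nat.le_zero] at h1 h2 h3
  rw [sigmaSum_eq_card_sub_card, sigmaSum_eq_card_sub_card, h1, h2, h3]
  rcases ht with ht | ht
  · have h4 : #{x ∈ A | x.2 = t} ≤ #(Finset.Icc 1 k) := card_snd_eq_le _ fun i j h e => by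
      have := hA' i j h; rw [mem_Icc]; omega
    rw [Nat.card_Icc] at h4
    refine ⟨2 * (p : ℤ) - k + 1 - t + #{x ∈ A | x.2 = t}, ?_, by omega, by omega⟩
    rw [lam0, if_neg (by omega), if_neg (by omega), if_pos (by omega)]
    push_cast
    ring
  · have h4 : #{x ∈ A | x.2 = t} ≤ #(Finset.Icc (k + 1) p) :=
      card_snd_eq_le _ fun i j h e => by
        have := hA' i j h; rw [mem_Icc]; omega
    rw [Nat.card_Icc] at h4
    refine ⟨(p : ℤ) + q + 1 - t + #{x ∈ A | x.2 = t}, ?_, by omega, by omega⟩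
    rw [lam0, if_neg (by omega), if_neg (by omega), if_neg (by omega), if_neg (by omega)]
    push_cast
    ring

/-- On the middle part of the second block the shifted coordinates are positive integers, and
the `l`-th one is at most `q - l + 1`. -/
theorem exists_int_mem_Icc_of_middle (hpq : p < q) (hk : k ≤ p)
    (hA : A ⊆ DeltaNL p q k) (hC : C ⊆ DeltaP1 p q k) {l : ℕ} (hl : 1 ≤ l) (hl' : l ≤ q - p) :
    ∃ m : ℤ, lam0 p q k (2 * p - k + l) - sigmaSum A (2 * p - k + l)
      - sigmaSum C (2 * p - k + l) = m ∧ 1 ≤ m ∧ m ≤ (q : ℤ) - l + 1 := by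
  have hA' := fun i j (h : (i, j) ∈ A) => mem_DeltaNL.mp (hA h)
  have hC' := fun i j (h : (i, j) ∈ C) => mem_DeltaP1.mp (hC h)
  obtain ⟨t, ht⟩ : ∃ t, t = 2 * p - k + l := ⟨_, rfl⟩
  rw [← ht]
  have h1 : #{x ∈ A | x.1 = t} ≤ #(∅ : Finset ℕ) := card_fst_eq_le _ fun i j h e => by
    have := hA' i j h; omega
  have h2 : #{x ∈ A | x.2 = t} ≤ #(∅ : Finset ℕ) := card_snd_eq_le _ fun i j h e => by
    have := hA' i j h; omega
  have h3 : #{x ∈ C | x.1 = t} ≤ #(Finset.Icc (k + 1) p) := card_fst_eq_le _ fun i j h e => by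
    have := hC' i j h; rw [mem_Icc]; omega
  have h4 : #{x ∈ C | x.2 = t} ≤ #(Finset.Icc 1 k) := card_snd_eq_le _ fun i j h e => by
    have := hC' i j h; rw [mem_Icc]; omega
  simp only [card_empty, Nat.le_zero] at h1 h2
  rw [Nat.card_Icc] at h3 h4
  rw [sigmaSum_eq_card_sub_card, sigmaSum_eq_card_sub_card, h1, h2]
  refine ⟨(q : ℤ) + 2 * p - 2 * k + 1 - t - #{x ∈ C | x.1 = t} + #{x ∈ C | x.2 = t},
    ?_, by omega, by omega⟩
  rw [lam0, if_neg (by omega), if_neg (by omega), if_neg (by omega), if_pos (by omega)]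
  push_cast
  ring

end Bounds

/-- An injective integer sequence on `{1, …, N}` with `a < f l ≤ a + N + 1 - l` is
`f l = a + N + 1 - l`. -/
theorem eq_of_injOn_of_staircase {N : ℕ} {a : ℤ} {f : ℕ → ℤ}
    (hf : Set.InjOn f (Set.Icc 1 N)) (hlow : ∀ l ∈ Set.Icc 1 N, a < f l)
    (hup : ∀ l ∈ Set.Icc 1 N, f l ≤ a + N + 1 - l) :
    ∀ l ∈ Set.Icc 1 N, f l = a + N + 1 - l := by
  suffices h : ∀ d l : ℕ, l ∈ Set.Icc 1 N → N - l = d → f l = a + N + 1 - l from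
    fun l hl => h _ l hl rfl
  intro d
  induction d using Nat.strong_induction_on with
  | _ d ih =>
    intro l hl hd
    have h1 := hlow l hl
    have h2 := hup l hl
    by_contra hne
    rw [Set.mem_Icc] at hl
    obtain ⟨l', hl'⟩ : ∃ l' : ℕ, (l' : ℤ) = a + N + 1 - f l :=
      ⟨(a + N + 1 - f l).toNat, by omega⟩
    have hmem : l' ∈ Set.Icc 1 N := by rw [Set.mem_Icc]; omega
    have h3 := ih (N - l') (by omega) l' hmem rfl
    have h4 : l' = l := hf hmem hl (by omega)
    omega

/-- Assuming `q > p`: if `A ⊆ Δ_n^+(𝔩)` and `C ⊆ Δ(𝔭_1)` satisfy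
`P_K(λ_0 − σ(A) − σ(C)) ≠ 0`, then `Λ = λ_0 − σ(A) − σ(C)` satisfies
`Λ_{2p−k+l} = q − l + 1` for every `l = 1, …, q−p`. -/
theorem stmt_4 (p q k : ℕ) (hp : 1 ≤ p) (hpq : p < q) (hk : k ≤ p)
    (A : Finset (ℕ × ℕ)) (hA : A ⊆ DeltaNL p q k)
    (C : Finset (ℕ × ℕ)) (hC : C ⊆ DeltaP1 p q k)
    (hne : PK p q (fun t => lam0 p q k t - sigmaSum A t - sigmaSum C t) ≠ 0) :
    ∀ l : ℕ, 1 ≤ l → l ≤ q - p →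
      lam0 p q k (2 * p - k + l) - sigmaSum A (2 * p - k + l) - sigmaSum C (2 * p - k + l)
        = (q : ℚ) - l + 1 := by
  have hinj := blockProd_injOn (right_ne_zero_of_mul hne)
  set Λ : ℕ → ℚ := fun t => lam0 p q k t - sigmaSum A t - sigmaSum C t
  set O := Finset.Icc (p + 1) (2 * p - k) ∪ Finset.Icc (p + q - k + 1) (p + q) with hO
  have hOcard : #O = p := by
    rw [hO, card_union_of_disjoint, Nat.card_Icc, Nat.card_Icc]
    · omega
    · rw [Finset.disjoint_left]
      intro x hx hx'
      rw [mem_Icc] at hx hx'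
      omega
  have hOsub : ∀ t ∈ O, t ∈ Finset.Icc (p + 1) (p + q) := by
    intro t ht
    simp only [hO, mem_union, mem_Icc] at ht ⊢
    omega
  have hOimage : O.image Λ = (Finset.Icc (1 : ℤ) p).image ((↑) : ℤ → ℚ) := by
    refine Finset.eq_of_subset_of_card_le ?_ ?_
    · intro x hx
      obtain ⟨t, ht, rfl⟩ := Finset.mem_image.mp hx
      obtain ⟨m, hm, h1, h2⟩ := exists_int_mem_Icc_of_outer hpq hk hA hC ht
      exact Finset.mem_image.mpr ⟨m, Finset.mem_Icc.mpr ⟨h1, h2⟩, hm.symm⟩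
    · rw [Finset.card_image_of_injOn (hinj.mono hOsub), hOcard]
      exact Finset.card_image_le.trans (by simp)
  have hmid : ∀ l : ℕ, ∃ m : ℤ, l ∈ Set.Icc 1 (q - p) →
      Λ (2 * p - k + l) = m ∧ 1 ≤ m ∧ m ≤ (q : ℤ) - l + 1 := by
    intro l
    by_cases hl : l ∈ Set.Icc 1 (q - p)
    · obtain ⟨m, hm⟩ := exists_int_mem_Icc_of_middle hpq hk hA hC hl.1 hl.2
      exact ⟨m, fun _ => hm⟩
    · exact ⟨0, fun h => absurd h hl⟩
  choose f hf using hmid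
  have hmem : ∀ l ∈ Set.Icc 1 (q - p), 2 * p - k + l ∈ Finset.Icc (p + 1) (p + q) := by
    intro l hl
    rw [Set.mem_Icc] at hl
    rw [mem_Icc]
    omega
  have hfinj : Set.InjOn f (Set.Icc 1 (q - p)) := by
    intro l hl l' hl' h
    have := hinj (hmem l hl) (hmem l' hl') (by rw [(hf l hl).1, (hf l' hl').1, h])
    omega
  have hlow : ∀ l ∈ Set.Icc 1 (q - p), (p : ℤ) < f l := by
    intro l hl
    by_contra! hle
    obtain ⟨hval, hpos, -⟩ := hf l hl
    have hval' : Λ (2 * p - k + l) ∈ O.image Λ := by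
      rw [hOimage, hval]
      exact Finset.mem_image_of_mem _ (Finset.mem_Icc.mpr ⟨hpos, hle⟩)
    obtain ⟨t, ht, htl⟩ := Finset.mem_image.mp hval'
    have := hinj (hOsub t ht) (hmem l hl) htl
    simp only [hO, mem_union, mem_Icc] at ht
    rw [Set.mem_Icc] at hl
    omega
  intro l hl1 hl2
  have hfl := eq_of_injOn_of_staircase hfinj hlow
    (fun l hl => by have := (hf l hl).2.2; omega) l ⟨hl1, hl2⟩
  have hfl' : f l = (q : ℤ) - l + 1 := by omega
  rw [show lam0 p q k (2 * p - k + l) - sigmaSum A (2 * p - k + l)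
    - sigmaSum C (2 * p - k + l) = f l from (hf l ⟨hl1, hl2⟩).1, hfl']
  push_cast
  ring
end

section
/- For every A ⊆ Δ_n^+(𝔩) and every C ⊆ Δ(𝔭_1), the vector Λ = λ_0 − σ(A) − σ(C) satisfies: (a) 1 ≤ Λ_j ≤ q for all j with p+1 ≤ j ≤ n; (b) Λ_{2p−k+l} ≤ q − l + 1 for every l = 1, …, q−p; (c) Λ_j ≤ p for every j ∈ {p+1, …, 2p−k} ∪ {p+q−k+1, …, n}. -/
open Finset

/-- Bounds for a coordinate of `σ(S)` in terms of the possible partners of the index `t`. -/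
theorem sigmaSum_mem_Icc {S : Finset (ℕ × ℕ)} {t : ℕ} {I J : Finset ℕ}
    (hI : ∀ x ∈ S, x.2 = t → x.1 ∈ I) (hJ : ∀ x ∈ S, x.1 = t → x.2 ∈ J) :
    sigmaSum S t ∈ Set.Icc (-(#I : ℚ)) #J := by
  have h₁ : #{x ∈ S | x.2 = t} ≤ #I := by
    refine card_le_card_of_injOn Prod.fst (fun x hx => ?_) (fun x hx y hy h => ?_)
    · simp only [coe_filter, Set.mem_ofPred_eq] at hx
      exact hI x hx.1 hx.2
    · simp only [coe_filter, Set.mem_ofPred_eq] at hx hy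
      exact Prod.ext h (hx.2.trans hy.2.symm)
  have h₂ : #{x ∈ S | x.1 = t} ≤ #J := by
    refine card_le_card_of_injOn Prod.snd (fun x hx => ?_) (fun x hx y hy h => ?_)
    · simp only [coe_filter, Set.mem_ofPred_eq] at hx
      exact hJ x hx.1 hx.2
    · simp only [coe_filter, Set.mem_ofPred_eq] at hx hy
      exact Prod.ext (hx.2.trans hy.2.symm) h
  have h₁' : (#{x ∈ S | x.2 = t} : ℚ) ≤ #I := by exact_mod_cast h₁
  have h₂' : (#{x ∈ S | x.1 = t} : ℚ) ≤ #J := by exact_mod_cast h₂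
  have h₃ : (0 : ℚ) ≤ #{x ∈ S | x.2 = t} := by positivity
  have h₄ : (0 : ℚ) ≤ #{x ∈ S | x.1 = t} := by positivity
  rw [sigmaSum_eq_card_sub_card]
  constructor <;> linarith

theorem sigmaSum_DeltaNL_left {p q k j : ℕ} (hpq : p ≤ q) (hk : k ≤ p) {A : Finset (ℕ × ℕ)}
    (hA : A ⊆ DeltaNL p q k) (hj : p + 1 ≤ j ∧ j ≤ 2 * p - k) :
    sigmaSum A j ∈ Set.Icc (-k : ℚ) 0 := by
  have h := sigmaSum_mem_Icc (S := A) (t := j) (I := Icc 1 k) (J := ∅)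
    (fun x hx hxj => by
      have := hA hx
      simp only [DeltaNL, mem_union, mem_product, mem_Icc] at this
      simp only [mem_Icc]
      omega)
    (fun x hx hxj => by
      have := hA hx
      simp only [DeltaNL, mem_union, mem_product, mem_Icc] at this
      simp only [notMem_empty]
      omega)
  simpa [Nat.cast_sub hk] using h

theorem sigmaSum_DeltaNL_middle {p q k j : ℕ} (hk : k ≤ p) {A : Finset (ℕ × ℕ)}
    (hA : A ⊆ DeltaNL p q k) (hj : 2 * p - k + 1 ≤ j ∧ j ≤ p + q - k) :
    sigmaSum A j ∈ Set.Icc (0 : ℚ) 0 := by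
  have h := sigmaSum_mem_Icc (S := A) (t := j) (I := ∅) (J := ∅)
    (fun x hx hxj => by
      have := hA hx
      simp only [DeltaNL, mem_union, mem_product, mem_Icc] at this
      simp only [notMem_empty]
      omega)
    (fun x hx hxj => by
      have := hA hx
      simp only [DeltaNL, mem_union, mem_product, mem_Icc] at this
      simp only [notMem_empty]
      omega)
  simpa [Nat.cast_sub hk] using h

theorem sigmaSum_DeltaNL_right {p q k j : ℕ} (hpq : p ≤ q) (hk : k ≤ p) {A : Finset (ℕ × ℕ)}
    (hA : A ⊆ DeltaNL p q k) (hj : p + q - k + 1 ≤ j ∧ j ≤ p + q) :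
    sigmaSum A j ∈ Set.Icc (-(p - k) : ℚ) 0 := by
  have h := sigmaSum_mem_Icc (S := A) (t := j) (I := Icc (k + 1) p) (J := ∅)
    (fun x hx hxj => by
      have := hA hx
      simp only [DeltaNL, mem_union, mem_product, mem_Icc] at this
      simp only [mem_Icc]
      omega)
    (fun x hx hxj => by
      have := hA hx
      simp only [DeltaNL, mem_union, mem_product, mem_Icc] at this
      simp only [notMem_empty]
      omega)
  simpa [Nat.cast_sub hk] using h

theorem sigmaSum_DeltaP1_outer {p q k j : ℕ} (hk : k ≤ p) {C : Finset (ℕ × ℕ)}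
    (hC : C ⊆ DeltaP1 p q k) (hj : (p + 1 ≤ j ∧ j ≤ 2 * p - k) ∨ (p + q - k + 1 ≤ j ∧ j ≤ p + q)) :
    sigmaSum C j ∈ Set.Icc (0 : ℚ) 0 := by
  have h := sigmaSum_mem_Icc (S := C) (t := j) (I := ∅) (J := ∅)
    (fun x hx hxj => by
      have := hC hx
      simp only [DeltaP1, mem_union, mem_product, mem_Icc] at this
      simp only [notMem_empty]
      omega)
    (fun x hx hxj => by
      have := hC hx
      simp only [DeltaP1, mem_union, mem_product, mem_Icc] at this
      simp only [notMem_empty]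
      omega)
  simpa [Nat.cast_sub hk] using h

theorem sigmaSum_DeltaP1_middle {p q k j : ℕ} (hk : k ≤ p) {C : Finset (ℕ × ℕ)}
    (hC : C ⊆ DeltaP1 p q k) (hj : 2 * p - k + 1 ≤ j ∧ j ≤ p + q - k) :
    sigmaSum C j ∈ Set.Icc (-k : ℚ) (p - k) := by
  have h := sigmaSum_mem_Icc (S := C) (t := j) (I := Icc 1 k) (J := Icc (k + 1) p)
    (fun x hx hxj => by
      have := hC hx
      simp only [DeltaP1, mem_union, mem_product, mem_Icc] at this
      simp only [mem_Icc]
      omega)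
    (fun x hx hxj => by
      have := hC hx
      simp only [DeltaP1, mem_union, mem_product, mem_Icc] at this
      simp only [mem_Icc]
      omega)
  simpa [Nat.cast_sub hk] using h

theorem lam0_left {p q k j : ℕ} (hk : k ≤ p) (hj : p + 1 ≤ j ∧ j ≤ 2 * p - k) :
    lam0 p q k j = 2 * (p : ℚ) - k + 1 - j := by
  rw [lam0, if_neg (by omega), if_neg (by omega), if_pos hj.2]

theorem lam0_middle {p q k j : ℕ} (hk : k ≤ p) (hj : 2 * p - k + 1 ≤ j ∧ j ≤ p + q - k) :
    lam0 p q k j = (q : ℚ) + 2 * p - 2 * k + 1 - j := by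
  rw [lam0, if_neg (by omega), if_neg (by omega), if_neg (by omega), if_pos hj.2]

theorem lam0_right {p q k j : ℕ} (hpq : p ≤ q) (hk : k ≤ p) (hj : p + q - k + 1 ≤ j ∧ j ≤ p + q) :
    lam0 p q k j = (p : ℚ) + q + 1 - j := by
  rw [lam0, if_neg (by omega), if_neg (by omega), if_neg (by omega), if_neg (by omega)]

/-- For every `A ⊆ Δ_n^+(𝔩)` and `C ⊆ Δ(𝔭_1)`, the vector `Λ = λ_0 − σ(A) − σ(C)` satisfies:
(a) `1 ≤ Λ_j ≤ q` for `p+1 ≤ j ≤ n`;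
(b) `Λ_{2p−k+l} ≤ q − l + 1` for `l = 1, …, q−p`;
(c) `Λ_j ≤ p` for `j ∈ {p+1, …, 2p−k} ∪ {p+q−k+1, …, n}`. -/
theorem stmt_5 (p q k : ℕ) (hp : 1 ≤ p) (hpq : p ≤ q) (hk : k ≤ p)
    (A : Finset (ℕ × ℕ)) (hA : A ⊆ DeltaNL p q k)
    (C : Finset (ℕ × ℕ)) (hC : C ⊆ DeltaP1 p q k) :
    (∀ j : ℕ, p + 1 ≤ j → j ≤ p + q →
        1 ≤ lam0 p q k j - sigmaSum A j - sigmaSum C j ∧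
        lam0 p q k j - sigmaSum A j - sigmaSum C j ≤ (q : ℚ)) ∧
    (∀ l : ℕ, 1 ≤ l → l ≤ q - p →
        lam0 p q k (2 * p - k + l) - sigmaSum A (2 * p - k + l) - sigmaSum C (2 * p - k + l)
          ≤ (q : ℚ) - l + 1) ∧
    (∀ j : ℕ, (p + 1 ≤ j ∧ j ≤ 2 * p - k) ∨ (p + q - k + 1 ≤ j ∧ j ≤ p + q) →
        lam0 p q k j - sigmaSum A j - sigmaSum C j ≤ (p : ℚ)) := by
  have hpq' : (p : ℚ) ≤ q := by exact_mod_cast hpq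
  have left : ∀ j : ℕ, p + 1 ≤ j ∧ j ≤ 2 * p - k →
      1 ≤ lam0 p q k j - sigmaSum A j - sigmaSum C j ∧
      lam0 p q k j - sigmaSum A j - sigmaSum C j ≤ (p : ℚ) := fun j hj => by
    have h₁ : ((p + 1 : ℕ) : ℚ) ≤ j := Nat.cast_le.2 hj.1
    have h₂ : ((j + k : ℕ) : ℚ) ≤ (2 * p : ℕ) := Nat.cast_le.2 (by omega)
    push_cast at h₁ h₂
    obtain ⟨hA₁, hA₂⟩ := sigmaSum_DeltaNL_left hpq hk hA hj
    obtain ⟨hC₁, hC₂⟩ := sigmaSum_DeltaP1_outer hk hC (Or.inl hj)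
    rw [lam0_left hk hj]
    constructor <;> linarith
  have middle : ∀ j : ℕ, 2 * p - k + 1 ≤ j ∧ j ≤ p + q - k →
      1 ≤ lam0 p q k j - sigmaSum A j - sigmaSum C j ∧
      lam0 p q k j - sigmaSum A j - sigmaSum C j ≤ (q : ℚ) + 2 * p - k + 1 - j := fun j hj => by
    have h₂ : ((j + k : ℕ) : ℚ) ≤ (p + q : ℕ) := Nat.cast_le.2 (by omega)
    push_cast at h₂
    obtain ⟨hA₁, hA₂⟩ := sigmaSum_DeltaNL_middle hk hA hj
    obtain ⟨hC₁, hC₂⟩ := sigmaSum_DeltaP1_middle hk hC hj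
    rw [lam0_middle hk hj]
    constructor <;> linarith
  have right : ∀ j : ℕ, p + q - k + 1 ≤ j ∧ j ≤ p + q →
      1 ≤ lam0 p q k j - sigmaSum A j - sigmaSum C j ∧
      lam0 p q k j - sigmaSum A j - sigmaSum C j ≤ (p : ℚ) := fun j hj => by
    have h₁ : ((p + q + 1 : ℕ) : ℚ) ≤ (j + k : ℕ) := Nat.cast_le.2 (by omega)
    have h₂ : (j : ℚ) ≤ (p + q : ℕ) := Nat.cast_le.2 hj.2
    push_cast at h₁ h₂
    obtain ⟨hA₁, hA₂⟩ := sigmaSum_DeltaNL_right hpq hk hA hj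
    obtain ⟨hC₁, hC₂⟩ := sigmaSum_DeltaP1_outer hk hC (Or.inr hj)
    rw [lam0_right hpq hk hj]
    constructor <;> linarith
  refine ⟨fun j hj₁ hj₂ => ?_, fun l hl₁ hl₂ => ?_, fun j hj => ?_⟩
  · by_cases h₃ : j ≤ 2 * p - k
    · exact ⟨(left j ⟨hj₁, h₃⟩).1, (left j ⟨hj₁, h₃⟩).2.trans hpq'⟩
    by_cases h₄ : j ≤ p + q - k
    · have hj : ((2 * p + 1 : ℕ) : ℚ) ≤ (j + k : ℕ) := Nat.cast_le.2 (by omega)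
      push_cast at hj
      obtain ⟨h₁, h₂⟩ := middle j ⟨by omega, h₄⟩
      exact ⟨h₁, by linarith⟩
    · obtain ⟨h₁, h₂⟩ := right j ⟨by omega, hj₂⟩
      exact ⟨h₁, h₂.trans hpq'⟩
  · refine (middle (2 * p - k + l) ⟨by omega, by omega⟩).2.trans ?_
    rw [Nat.cast_add, Nat.cast_sub (by omega : k ≤ 2 * p)]
    push_cast
    linarith
  · exact hj.elim (fun h => (left j h).2) (fun h => (right j h).2)
end

section
/- Assume p = q. For every (k, p−k)-shuffle sh of (p, p−1, …, 1) with sequences i_1 > ⋯ > i_k and j_1 > ⋯ > j_{p−k}: the set A(sh) has exactly k(p−k) elements, the vector λ_0 − σ(A(sh)) equals (i_1, …, i_k, j_1, …, j_{p−k}, j_1, …, j_{p−k}, i_1, …, i_k), and P_K(λ_0 − σ(A(sh))) ≠ 0. -/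
open Finset

/-- A `(k, p−k)`-shuffle of `(p, p−1, …, 1)`: a pair of strictly decreasing integer sequences
`i_1 > ⋯ > i_k` and `j_1 > ⋯ > j_{p−k}` whose underlying sets partition `{1, …, p}`. -/
def IsShuffle (p k : ℕ) (ii jj : ℕ → ℕ) : Prop :=
  (∀ a b : ℕ, 1 ≤ a → a < b → b ≤ k → ii b < ii a) ∧
  (∀ a b : ℕ, 1 ≤ a → a < b → b ≤ p - k → jj b < jj a) ∧
  ((Finset.Icc 1 k).image ii ∪ (Finset.Icc 1 (p - k)).image jj = Finset.Icc 1 p) ∧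
  Disjoint ((Finset.Icc 1 k).image ii) ((Finset.Icc 1 (p - k)).image jj)

/-- The subset `A(sh) = {α_{a,b} : 1 ≤ a ≤ k, 1 ≤ b ≤ p−k}` of `Δ_n^+(𝔩)` associated to a
shuffle, where `α_{a,b} = e_a − e_{p+b}` if `i_a < j_b` and
`α_{a,b} = e_{k+b} − e_{2p−k+a}` if `i_a > j_b` (vectors encoded by index pairs). -/
def shuffleSet (p k : ℕ) (ii jj : ℕ → ℕ) : Finset (ℕ × ℕ) :=
  (Finset.Icc 1 k ×ˢ Finset.Icc 1 (p - k)).image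
    (fun ab => if ii ab.1 < jj ab.2 then (ab.1, p + ab.2) else (k + ab.2, 2 * p - k + ab.1))

theorem IsShuffle.swap {p k : ℕ} {ii jj : ℕ → ℕ} (hk : k ≤ p) (hsh : IsShuffle p k ii jj) :
    IsShuffle p (p - k) jj ii := by
  obtain ⟨hi, hj, hu, hd⟩ := hsh
  have hpk : p - (p - k) = k := by omega
  exact ⟨hj, by rwa [hpk], by rwa [hpk, union_comm], by rw [hpk]; exact hd.symm⟩

/-- In a decreasing enumeration of `{1, …, p}` split into two decreasing sequences, the value
`i_a` is determined by the number of larger entries. -/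
theorem IsShuffle.card_lt_add {p k : ℕ} {ii jj : ℕ → ℕ} (hsh : IsShuffle p k ii jj) {a : ℕ}
    (ha : 1 ≤ a) (hak : a ≤ k) :
    #{b ∈ Icc 1 (p - k) | ii a < jj b} + a + ii a = p + 1 := by
  obtain ⟨hi, hj, hu, hd⟩ := hsh
  have hle : ii a ≤ p := by
    have : ii a ∈ Icc 1 p := by
      rw [← hu]
      exact mem_union_left _ (mem_image_of_mem _ (mem_Icc.2 ⟨ha, hak⟩))
    exact (mem_Icc.1 this).2
  have hlt : ∀ c ∈ Icc 1 k, (ii a < ii c ↔ c < a) := by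
    intro c hc
    rw [mem_Icc] at hc
    rcases lt_trichotomy c a with h | rfl | h
    · simp [h, hi c a hc.1 h hak]
    · simp
    · have := hi a c ha h hc.2
      constructor <;> intro <;> omega
  have hset : Ioc (ii a) p =
      (Ico 1 a).image ii ∪ {b ∈ Icc 1 (p - k) | ii a < jj b}.image jj := by
    ext x
    have hx := Finset.ext_iff.1 hu.symm x
    simp only [mem_union, mem_image, mem_Icc, mem_Ioc, mem_Ico, mem_filter] at hx hlt ⊢
    constructor
    · rintro ⟨h1, h2⟩
      rcases hx.1 ⟨by omega, h2⟩ with ⟨c, hc, rfl⟩ | ⟨c, hc, rfl⟩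
      · exact Or.inl ⟨c, ⟨hc.1, (hlt c hc).1 h1⟩, rfl⟩
      · exact Or.inr ⟨c, ⟨hc, h1⟩, rfl⟩
    · rintro (⟨c, hc, rfl⟩ | ⟨c, hc, rfl⟩)
      · have hck : 1 ≤ c ∧ c ≤ k := ⟨hc.1, by omega⟩
        exact ⟨(hlt c hck).2 hc.2, (hx.2 (Or.inl ⟨c, hck, rfl⟩)).2⟩
      · exact ⟨hc.2, (hx.2 (Or.inr ⟨c, hc.1, rfl⟩)).2⟩
  have hcard := congrArg card hset
  rw [card_union_of_disjoint, card_image_of_injOn, card_image_of_injOn, Nat.card_Ioc,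
    Nat.card_Ico] at hcard
  · omega
  · intro b hb c hc h
    simp only [coe_filter, Set.mem_ofPred_eq, mem_Icc] at hb hc
    rcases lt_trichotomy b c with h' | h' | h'
    · have := hj b c hb.1.1 h' hc.1.2
      omega
    · exact h'
    · have := hj c b hc.1.1 h' hb.1.2
      omega
  · intro b hb c hc h
    simp only [coe_Ico, Set.mem_Ico] at hb hc
    rcases lt_trichotomy b c with h' | h' | h'
    · have := hi b c hb.1 h' (by omega)
      omega
    · exact h'
    · have := hi c b hc.1 h' (by omega)
      omega
  · refine hd.mono (image_subset_image ?_) (image_subset_image (filter_subset _ _))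
    intro x
    simp only [mem_Ico, mem_Icc]
    omega

theorem IsShuffle.ne {p k : ℕ} {ii jj : ℕ → ℕ} (hsh : IsShuffle p k ii jj) {a b : ℕ}
    (ha : a ∈ Icc 1 k) (hb : b ∈ Icc 1 (p - k)) : ii a ≠ jj b :=
  disjoint_iff_ne.1 hsh.2.2.2 _ (mem_image_of_mem _ ha) _ (mem_image_of_mem _ hb)

theorem IsShuffle.card_gt_add {p k : ℕ} {ii jj : ℕ → ℕ} (hsh : IsShuffle p k ii jj) {a : ℕ}
    (ha : 1 ≤ a) (hak : a ≤ k) (hk : k ≤ p) :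
    #{b ∈ Icc 1 (p - k) | jj b < ii a} + k + 1 = a + ii a := by
  have h := hsh.card_lt_add ha hak
  have hsum := card_filter_add_card_filter_not (s := Icc 1 (p - k)) (fun b => ii a < jj b)
  have heq : {b ∈ Icc 1 (p - k) | ¬ ii a < jj b} = {b ∈ Icc 1 (p - k) | jj b < ii a} := by
    refine filter_congr fun b hb => ?_
    have := hsh.ne (mem_Icc.2 ⟨ha, hak⟩) hb
    omega
  rw [heq, Nat.card_Icc] at hsum
  omega

theorem shuffleSet_injOn {p k : ℕ} (ii jj : ℕ → ℕ) :
    Set.InjOn (fun ab : ℕ × ℕ =>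
      if ii ab.1 < jj ab.2 then (ab.1, p + ab.2) else (k + ab.2, 2 * p - k + ab.1))
      (Icc 1 k ×ˢ Icc 1 (p - k) : Finset (ℕ × ℕ)) := by
  rintro ⟨a, b⟩ hab ⟨c, d⟩ hcd h
  simp only [coe_product, coe_Icc, Set.mem_prod, Set.mem_Icc] at hab hcd
  dsimp only at h
  split_ifs at h <;> simp only [Prod.mk.injEq] at h ⊢ <;> omega

theorem card_shuffleSet {p k : ℕ} (ii jj : ℕ → ℕ) :
    (shuffleSet p k ii jj).card = k * (p - k) := by
  rw [shuffleSet, card_image_of_injOn (shuffleSet_injOn ii jj)]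
  simp

theorem sigmaSum_shuffleSet {p k : ℕ} (ii jj : ℕ → ℕ) (t : ℕ) :
    sigmaSum (shuffleSet p k ii jj) t =
      ∑ a ∈ Icc 1 k, ∑ b ∈ Icc 1 (p - k),
        if ii a < jj b then root a (p + b) t else root (k + b) (2 * p - k + a) t := by
  rw [sigmaSum, shuffleSet, sum_image (shuffleSet_injOn ii jj), sum_product]
  refine sum_congr rfl fun a _ => sum_congr rfl fun b _ => ?_
  dsimp only
  split_ifs <;> rfl

section Coordinates

variable {p k : ℕ} {ii jj : ℕ → ℕ}

theorem sum_ite_left (f : ℕ → ℕ → ℚ) (a₀ : ℕ) (ha : a₀ ∈ Icc 1 k) (c : ℚ)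
    (P : ℕ → Prop) [DecidablePred P]
    (h : ∀ a ∈ Icc 1 k, ∀ b ∈ Icc 1 (p - k), f a b = if a = a₀ ∧ P b then c else 0) :
    ∑ a ∈ Icc 1 k, ∑ b ∈ Icc 1 (p - k), f a b = #{b ∈ Icc 1 (p - k) | P b} * c := by
  rw [sum_eq_single_of_mem a₀ ha]
  · rw [sum_congr rfl (h a₀ ha), ← nsmul_eq_mul, ← sum_const, sum_filter]
    simp
  · intro a ha' hne
    rw [sum_congr rfl (h a ha')]
    simp [hne]

theorem sigmaSum_shuffleSet_fst (hk : k ≤ p) {a : ℕ} (ha : 1 ≤ a) (hak : a ≤ k) :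
    sigmaSum (shuffleSet p k ii jj) a = #{b ∈ Icc 1 (p - k) | ii a < jj b} := by
  rw [sigmaSum_shuffleSet ii jj,
    sum_ite_left _ a (mem_Icc.2 ⟨ha, hak⟩) 1 (fun b => ii a < jj b), mul_one]
  intro c hc b hb
  rw [mem_Icc] at hc hb
  unfold root
  grind

theorem sigmaSum_shuffleSet_fourth (hk : k ≤ p) (hsh : IsShuffle p k ii jj) {a : ℕ}
    (ha : 1 ≤ a) (hak : a ≤ k) :
    sigmaSum (shuffleSet p k ii jj) (2 * p - k + a) =
      -#{b ∈ Icc 1 (p - k) | jj b < ii a} := by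
  rw [sigmaSum_shuffleSet ii jj,
    sum_ite_left _ a (mem_Icc.2 ⟨ha, hak⟩) (-1) (fun b => jj b < ii a), mul_neg_one]
  intro c hc b hb
  have hne := hsh.ne hc hb
  rw [mem_Icc] at hc hb
  unfold root
  grind

theorem sigmaSum_shuffleSet_snd (hk : k ≤ p) (hsh : IsShuffle p k ii jj) {b : ℕ}
    (hb : 1 ≤ b) (hbk : b ≤ p - k) :
    sigmaSum (shuffleSet p k ii jj) (k + b) = #{a ∈ Icc 1 k | jj b < ii a} := by
  have hpk : p - (p - k) = k := by omega
  have key := sum_ite_left (p := p) (k := p - k)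
    (fun b' a => if ii a < jj b' then root a (p + b') (k + b)
      else root (k + b') (2 * p - k + a) (k + b)) b
    (mem_Icc.2 ⟨hb, hbk⟩) 1 (fun a => jj b < ii a)
  rw [hpk] at key
  rw [sigmaSum_shuffleSet ii jj, sum_comm, key, mul_one]
  intro c hc a ha
  have hne := hsh.ne ha hc
  rw [mem_Icc] at hc ha
  unfold root
  grind

theorem sigmaSum_shuffleSet_third (hk : k ≤ p) {b : ℕ}
    (hb : 1 ≤ b) (hbk : b ≤ p - k) :
    sigmaSum (shuffleSet p k ii jj) (p + b) = -#{a ∈ Icc 1 k | ii a < jj b} := by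
  have hpk : p - (p - k) = k := by omega
  have key := sum_ite_left (p := p) (k := p - k)
    (fun b' a => if ii a < jj b' then root a (p + b') (p + b)
      else root (k + b') (2 * p - k + a) (p + b)) b
    (mem_Icc.2 ⟨hb, hbk⟩) (-1) (fun a => ii a < jj b)
  rw [hpk] at key
  rw [sigmaSum_shuffleSet ii jj, sum_comm, key, mul_neg_one]
  intro c hc a ha
  rw [mem_Icc] at hc ha
  unfold root
  grind

end Coordinates

/-- The coordinates of `λ_0 − σ(A(sh))`. -/
theorem lam0_sub_sigmaSum_shuffleSet {p k : ℕ} {ii jj : ℕ → ℕ} (hk : k ≤ p)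
    (hsh : IsShuffle p k ii jj) (t : ℕ) (ht : 1 ≤ t) (htp : t ≤ p + p) :
    lam0 p p k t - sigmaSum (shuffleSet p k ii jj) t =
      if t ≤ k then (ii t : ℚ)
      else if t ≤ p then (jj (t - k) : ℚ)
      else if t ≤ 2 * p - k then (jj (t - p) : ℚ)
      else (ii (t - (2 * p - k)) : ℚ) := by
  have hpk : p - (p - k) = k := by omega
  unfold lam0
  split_ifs with h1 h2 h3 h4
  · rw [sigmaSum_shuffleSet_fst hk ht h1]
    have := hsh.card_lt_add ht h1
    replace this := congrArg (Nat.cast (R := ℚ)) this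
    push_cast at this
    linarith
  · obtain ⟨b, rfl⟩ := Nat.exists_eq_add_of_le (not_le.1 h1).le
    have hb : 1 ≤ b := by omega
    have hbk : b ≤ p - k := by omega
    rw [sigmaSum_shuffleSet_snd hk hsh hb hbk, Nat.add_sub_cancel_left]
    have := (hsh.swap hk).card_lt_add hb hbk
    rw [hpk] at this
    replace this := congrArg (Nat.cast (R := ℚ)) this
    push_cast at this
    push_cast
    linarith
  · obtain ⟨b, rfl⟩ := Nat.exists_eq_add_of_le (not_le.1 h2).le
    have hb : 1 ≤ b := by omega
    have hbk : b ≤ p - k := by omega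
    rw [sigmaSum_shuffleSet_third hk hb hbk, Nat.add_sub_cancel_left]
    have := (hsh.swap hk).card_gt_add hb hbk (Nat.sub_le _ _)
    rw [hpk] at this
    replace this := congrArg (Nat.cast (R := ℚ)) this
    push_cast [hk] at this
    push_cast
    linarith
  · omega
  · obtain ⟨a, rfl⟩ := Nat.exists_eq_add_of_le (not_le.1 h3).le
    have ha : 1 ≤ a := by omega
    have hak : a ≤ k := by omega
    rw [sigmaSum_shuffleSet_fourth hk hsh ha hak, Nat.add_sub_cancel_left]
    have := hsh.card_gt_add ha hak hk
    replace this := congrArg (Nat.cast (R := ℚ)) this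
    push_cast at this
    have hk2 : k ≤ 2 * p := by omega
    push_cast [hk2]
    linarith

theorem blockProd_ne_zero {B : Finset ℕ} {lam : ℕ → ℚ}
    (h : ∀ i ∈ B, ∀ j ∈ B, i < j → lam i ≠ lam j) : blockProd B lam ≠ 0 := by
  refine prod_ne_zero_iff.2 fun i hi => prod_ne_zero_iff.2 fun j hj => ?_
  split_ifs with hij
  · refine div_ne_zero (sub_ne_zero.2 (h i hi j hj hij)) (sub_ne_zero.2 ?_)
    exact_mod_cast hij.ne'
  · exact one_ne_zero

/-- Assume `p = q`. For every `(k, p−k)`-shuffle `sh` of `(p, p−1, …, 1)`: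
`A(sh)` has exactly `k(p−k)` elements, the vector `λ_0 − σ(A(sh))` equals
`(i_1, …, i_k, j_1, …, j_{p−k}, j_1, …, j_{p−k}, i_1, …, i_k)`, and
`P_K(λ_0 − σ(A(sh))) ≠ 0`. -/
theorem stmt_7 (p k : ℕ) (hp : 1 ≤ p) (hk : k ≤ p)
    (ii jj : ℕ → ℕ) (hsh : IsShuffle p k ii jj) :
    (shuffleSet p k ii jj).card = k * (p - k) ∧
    (∀ t : ℕ, 1 ≤ t → t ≤ p + p →
      lam0 p p k t - sigmaSum (shuffleSet p k ii jj) t =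
        if t ≤ k then (ii t : ℚ)
        else if t ≤ p then (jj (t - k) : ℚ)
        else if t ≤ 2 * p - k then (jj (t - p) : ℚ)
        else (ii (t - (2 * p - k)) : ℚ)) ∧
    PK p p (fun t => lam0 p p k t - sigmaSum (shuffleSet p k ii jj) t) ≠ 0 := by
  refine ⟨card_shuffleSet ii jj, lam0_sub_sigmaSum_shuffleSet hk hsh, ?_⟩
  have hne : ∀ a b, 1 ≤ a → a ≤ k → 1 ≤ b → b ≤ p - k → ii a ≠ jj b :=
    fun a b h1 h2 h3 h4 => hsh.ne (mem_Icc.2 ⟨h1, h2⟩) (mem_Icc.2 ⟨h3, h4⟩)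
  refine mul_ne_zero (blockProd_ne_zero ?_) (blockProd_ne_zero ?_)
  · intro i hi j hj hij
    rw [mem_Icc] at hi hj
    rw [lam0_sub_sigmaSum_shuffleSet hk hsh i hi.1 (by omega),
      lam0_sub_sigmaSum_shuffleSet hk hsh j hj.1 (by omega), if_pos hi.2, if_pos hj.2]
    split_ifs with h1 h2 h2
    · exact_mod_cast (hsh.1 i j hi.1 hij h2).ne'
    · exact_mod_cast hne i (j - k) hi.1 h1 (by omega) (by omega)
    · omega
    · exact_mod_cast (hsh.2.1 (i - k) (j - k) (by omega) (by omega) (by omega)).ne'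
  · intro i hi j hj hij
    rw [mem_Icc] at hi hj
    rw [lam0_sub_sigmaSum_shuffleSet hk hsh i (by omega) (by omega),
      lam0_sub_sigmaSum_shuffleSet hk hsh j (by omega) (by omega),
      if_neg (by omega : ¬ i ≤ k), if_neg (by omega : ¬ i ≤ p),
      if_neg (by omega : ¬ j ≤ k), if_neg (by omega : ¬ j ≤ p)]
    split_ifs with h1 h2 h2
    · exact_mod_cast (hsh.2.1 (i - p) (j - p) (by omega) (by omega) (by omega)).ne'
    · exact_mod_cast (hne (j - (2 * p - k)) (i - p) (by omega) (by omega) (by omega)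
        (by omega)).symm
    · omega
    · exact_mod_cast (hsh.1 (i - (2 * p - k)) (j - (2 * p - k)) (by omega) (by omega)
        (by omega)).ne'
end

section
/- For every (k, p−k)-shuffle of (p, p−1, …, 1) with sequences i_1 > ⋯ > i_k and j_1 > ⋯ > j_{p−k}, the vector Λ ∈ ℚ^n with coordinates (i_1, …, i_k, j_1, …, j_{p−k}, j_1, …, j_{p−k}, q, q−1, …, p+1, i_1, …, i_k) satisfies P_K(Λ) = (−1)^{(p−k)(q−p+k)}. -/
open Finset

/-- The product of `|x - y|` over ordered pairs of distinct elements, pulled back along an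
injective map, is the square of the product over increasing pairs of indices. -/
lemma prod_abs_sub_image {B : Finset ℕ} {f : ℕ → ℚ} (hf : Set.InjOn f B) :
    ∏ x ∈ B.image f, ∏ y ∈ B.image f, (if x = y then 1 else |x - y|) =
      (∏ i ∈ B, ∏ j ∈ B, if i < j then |f i - f j| else 1) ^ 2 := by
  rw [prod_image hf, sq]
  conv_rhs => arg 2; rw [prod_comm]
  rw [← prod_mul_distrib]
  refine prod_congr rfl fun i hi => ?_
  rw [prod_image hf, ← prod_mul_distrib]
  refine prod_congr rfl fun j hj => ?_
  rcases lt_trichotomy i j with h | h | h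
  · have : f i ≠ f j := fun e => h.ne (hf hi hj e)
    simp [this, h, h.not_gt]
  · simp [h]
  · have : f i ≠ f j := fun e => h.ne' (hf hi hj e)
    simp [this, h, h.not_gt, abs_sub_comm]

/-- The sign `(-1)^N`, where `N` is the number of pairs `i < j` in `B` with `f i < f j`. -/
def ascentSign (B : Finset ℕ) (f : ℕ → ℚ) : ℚ :=
  ∏ i ∈ B, ∏ j ∈ B, if i < j ∧ f i < f j then -1 else 1

/-- If `f` maps `B` onto a translate of `B`, then `blockProd B f` is a sign. -/
lemma blockProd_eq_ascentSign {B : Finset ℕ} {f : ℕ → ℚ} (c : ℚ)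
    (h : ∀ i ∈ B, ∃ a ∈ B, f a = i + c) : blockProd B f = ascentSign B f := by
  have hg : Set.InjOn (fun i : ℕ => (i : ℚ) + c) B := fun i _ j _ e => by
    simpa using e
  have himg : B.image (fun i : ℕ => (i : ℚ) + c) = B.image f := by
    refine eq_of_subset_of_card_le ?_ ?_
    · intro x hx
      obtain ⟨i, hi, rfl⟩ := mem_image.1 hx
      obtain ⟨a, ha, hfa⟩ := h i hi
      exact mem_image.2 ⟨a, ha, hfa⟩
    · rw [card_image_of_injOn hg]
      exact card_image_le
  have hf : Set.InjOn f B := by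
    rw [← card_image_iff, ← himg, card_image_of_injOn hg]
  have hsq := prod_abs_sub_image hf
  rw [← himg, prod_abs_sub_image hg] at hsq
  have hpos : ∀ u : ℕ → ℚ, 0 ≤ ∏ i ∈ B, ∏ j ∈ B, if i < j then |u i - u j| else 1 := fun u =>
    prod_nonneg fun i _ => prod_nonneg fun j _ => by split_ifs <;> positivity
  have habs := (sq_eq_sq₀ (hpos _) (hpos _)).1 hsq
  have hne : (∏ i ∈ B, ∏ j ∈ B, if i < j then |((i : ℚ) + c) - (j + c)| else 1) ≠ 0 := by
    refine prod_ne_zero_iff.2 fun i hi => prod_ne_zero_iff.2 fun j hj => ?_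
    split_ifs with hij
    · have : (i : ℚ) ≠ j := by exact_mod_cast hij.ne
      simpa [sub_eq_zero] using this
    · exact one_ne_zero
  have hfac : blockProd B f *
      (∏ i ∈ B, ∏ j ∈ B, if i < j then |((i : ℚ) + c) - (j + c)| else 1) =
      ascentSign B f * ∏ i ∈ B, ∏ j ∈ B, if i < j then |f i - f j| else 1 := by
    unfold blockProd ascentSign
    simp only [← prod_mul_distrib]
    refine prod_congr rfl fun i hi => prod_congr rfl fun j hj => ?_
    by_cases hij : i < j
    · have hc : (0 : ℚ) < (j : ℚ) - i := sub_pos.2 (by exact_mod_cast hij)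
      have hd : |((i : ℚ) + c) - (j + c)| = (j : ℚ) - i := by
        rw [add_sub_add_right_eq_sub, abs_sub_comm, abs_of_pos hc]
      simp only [hij, if_true, true_and, hd, div_mul_cancel₀ _ hc.ne']
      split_ifs with hlt
      · rw [abs_of_neg (sub_neg.2 hlt)]
        ring
      · rw [abs_of_nonneg (sub_nonneg.2 (not_lt.1 hlt)), one_mul]
    · simp [hij]
  rw [← habs] at hfac
  exact mul_right_cancel₀ hne hfac

lemma ascentSign_union {A C : Finset ℕ} (f : ℕ → ℚ) (h : ∀ a ∈ A, ∀ c ∈ C, a < c) :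
    ascentSign (A ∪ C) f = ascentSign A f * ascentSign C f *
      ∏ a ∈ A, ∏ c ∈ C, if f a < f c then -1 else 1 := by
  have hd : Disjoint A C := disjoint_left.2 fun x hA hC => lt_irrefl _ (h x hA x hC)
  have hAC : ∏ a ∈ A, ∏ c ∈ C, (if a < c ∧ f a < f c then (-1 : ℚ) else 1) =
      ∏ a ∈ A, ∏ c ∈ C, if f a < f c then -1 else 1 :=
    prod_congr rfl fun a ha => prod_congr rfl fun c hc => by simp [h a ha c hc]
  have hCA : ∏ c ∈ C, ∏ a ∈ A, (if c < a ∧ f c < f a then (-1 : ℚ) else 1) = 1 :=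
    prod_eq_one fun c hc => prod_eq_one fun a ha => by simp [(h a ha c hc).not_gt]
  unfold ascentSign
  simp only [prod_union hd, prod_mul_distrib, hAC, hCA]
  ring

lemma ascentSign_eq_one {B : Finset ℕ} {f : ℕ → ℚ}
    (h : ∀ i ∈ B, ∀ j ∈ B, i < j → f j < f i) : ascentSign B f = 1 :=
  prod_eq_one fun i hi => prod_eq_one fun j hj => if_neg fun ⟨hij, hlt⟩ =>
    lt_asymm hlt (h i hi j hj hij)

lemma prod_Icc_shift {m n c l : ℕ} (hm : m = c + 1) (hn : n = c + l) (g : ℕ → ℚ) :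
    ∏ t ∈ Icc m n, g t = ∏ t ∈ Icc 1 l, g (c + t) := by
  subst hm hn
  have : Icc (c + 1) (c + l) = (Icc 1 l).map (addLeftEmbedding c) := by simp
  rw [this, prod_map]
  simp

/-- For every `(k, p−k)`-shuffle of `(p, p−1, …, 1)`, the vector
`Λ = (i_1, …, i_k, j_1, …, j_{p−k}, j_1, …, j_{p−k}, q, q−1, …, p+1, i_1, …, i_k) ∈ ℚ^n`
satisfies `P_K(Λ) = (−1)^{(p−k)(q−p+k)}`. -/
theorem stmt_8 (p q k : ℕ) (hp : 1 ≤ p) (hpq : p ≤ q) (hk : k ≤ p)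
    (ii jj : ℕ → ℕ) (hsh : IsShuffle p k ii jj) :
    PK p q (fun t =>
        if t ≤ k then (ii t : ℚ)
        else if t ≤ p then (jj (t - k) : ℚ)
        else if t ≤ 2 * p - k then (jj (t - p) : ℚ)
        else if t ≤ p + q - k then (q : ℚ) + 2 * p - k + 1 - t
        else (ii (t - (p + q - k)) : ℚ))
      = (-1 : ℚ) ^ ((p - k) * (q - p + k)) := by
  obtain ⟨hii, hjj, hun, hdis⟩ := hsh
  set L : ℕ → ℚ := fun t =>
        if t ≤ k then (ii t : ℚ)
        else if t ≤ p then (jj (t - k) : ℚ)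
        else if t ≤ 2 * p - k then (jj (t - p) : ℚ)
        else if t ≤ p + q - k then (q : ℚ) + 2 * p - k + 1 - t
        else (ii (t - (p + q - k)) : ℚ) with hL
  have hL1 : ∀ a ∈ Icc 1 k, L a = ii a := fun a ha => by
    simp only [hL, if_pos (mem_Icc.1 ha).2]
  have hL2 : ∀ b ∈ Icc 1 (p - k), L (k + b) = jj b := fun b hb => by
    have := mem_Icc.1 hb
    simp only [hL]
    rw [if_neg (by omega), if_pos (by omega), Nat.add_sub_cancel_left]
  have hL3 : ∀ b ∈ Icc 1 (p - k), L (p + b) = jj b := fun b hb => by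
    have := mem_Icc.1 hb
    simp only [hL]
    rw [if_neg (by omega), if_neg (by omega), if_pos (by omega), Nat.add_sub_cancel_left]
  have hL4 : ∀ c ∈ Icc 1 (q - p), L (2 * p - k + c) = (q : ℚ) + 1 - c := fun c hc => by
    have := mem_Icc.1 hc
    simp only [hL]
    rw [if_neg (by omega), if_neg (by omega), if_neg (by omega), if_pos (by omega)]
    push_cast [Nat.cast_sub (show k ≤ 2 * p by omega)]
    ring
  have hL5 : ∀ a ∈ Icc 1 k, L (p + q - k + a) = ii a := fun a ha => by
    have := mem_Icc.1 ha
    simp only [hL]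
    rw [if_neg (by omega), if_neg (by omega), if_neg (by omega), if_neg (by omega),
      Nat.add_sub_cancel_left]
  clear_value L
  have hii_le : ∀ a ∈ Icc 1 k, ii a ≤ p := fun a ha =>
    (mem_Icc.1 (hun ▸ mem_union_left _ (mem_image_of_mem ii ha))).2
  have hjj_le : ∀ b ∈ Icc 1 (p - k), jj b ≤ p := fun b hb =>
    (mem_Icc.1 (hun ▸ mem_union_right _ (mem_image_of_mem jj hb))).2
  have hne : ∀ a ∈ Icc 1 k, ∀ b ∈ Icc 1 (p - k), ii a ≠ jj b := fun a ha b hb e =>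
    disjoint_left.1 hdis (mem_image_of_mem ii ha) (e ▸ mem_image_of_mem jj hb)
  have hsurj : ∀ x ∈ Icc 1 p, (∃ a ∈ Icc 1 k, ii a = x) ∨ ∃ b ∈ Icc 1 (p - k), jj b = x := by
    intro x hx
    simpa only [← hun, mem_union, mem_image] using hx
  have hB1 : blockProd (Icc 1 p) L = ascentSign (Icc 1 p) L := by
    refine blockProd_eq_ascentSign 0 fun x hx => ?_
    rcases hsurj x hx with ⟨a, ha, rfl⟩ | ⟨b, hb, rfl⟩
    · exact ⟨a, by simp only [mem_Icc] at ha ⊢; omega, by simp [hL1 a ha]⟩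
    · exact ⟨k + b, by simp only [mem_Icc] at hb ⊢; omega, by simp [hL2 b hb]⟩
  have hB2 : blockProd (Icc (p + 1) (p + q)) L = ascentSign (Icc (p + 1) (p + q)) L := by
    refine blockProd_eq_ascentSign (-p) fun x hx => ?_
    obtain ⟨y, rfl⟩ := Nat.exists_eq_add_of_le (show p ≤ x by have := mem_Icc.1 hx; omega)
    have hy := mem_Icc.1 hx
    by_cases hyp : y ≤ p
    · rcases hsurj y (mem_Icc.2 ⟨by omega, hyp⟩) with ⟨a, ha, rfl⟩ | ⟨b, hb, rfl⟩
      · exact ⟨p + q - k + a, by simp only [mem_Icc] at ha ⊢; omega, by simp [hL5 a ha]⟩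
      · exact ⟨p + b, by simp only [mem_Icc] at hb ⊢; omega, by simp [hL3 b hb]⟩
    · refine ⟨2 * p - k + (q + 1 - y), by simp only [mem_Icc]; omega, ?_⟩
      rw [hL4 _ (by simp only [mem_Icc]; omega)]
      push_cast [Nat.cast_sub (show y ≤ q + 1 by omega)]
      ring
  -- Elements of each index interval, written relative to its left endpoint.
  have hshift : ∀ c l i : ℕ, i ∈ Icc (c + 1) (c + l) → ∃ a ∈ Icc 1 l, i = c + a :=
    fun c l i hi => ⟨i - c, by simp only [mem_Icc] at hi ⊢; omega, by
      simp only [mem_Icc] at hi; omega⟩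
  have hD1 : ascentSign (Icc 1 k) L = 1 := ascentSign_eq_one fun i hi j hj hij => by
    rw [hL1 i hi, hL1 j hj]
    exact_mod_cast hii i j (mem_Icc.1 hi).1 hij (mem_Icc.1 hj).2
  have hD2 : ascentSign (Icc (k + 1) (k + (p - k))) L = 1 :=
    ascentSign_eq_one fun i hi j hj hij => by
      obtain ⟨a, ha, rfl⟩ := hshift _ _ _ hi
      obtain ⟨b, hb, rfl⟩ := hshift _ _ _ hj
      rw [hL2 a ha, hL2 b hb]
      exact_mod_cast hjj a b (mem_Icc.1 ha).1 (by omega) (mem_Icc.1 hb).2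
  have hD3 : ascentSign (Icc (p + 1) (p + (p - k))) L = 1 :=
    ascentSign_eq_one fun i hi j hj hij => by
      obtain ⟨a, ha, rfl⟩ := hshift _ _ _ hi
      obtain ⟨b, hb, rfl⟩ := hshift _ _ _ hj
      rw [hL3 a ha, hL3 b hb]
      exact_mod_cast hjj a b (mem_Icc.1 ha).1 (by omega) (mem_Icc.1 hb).2
  have hD4 : ascentSign (Icc (2 * p - k + 1) (2 * p - k + (q - p))) L = 1 :=
    ascentSign_eq_one fun i hi j hj hij => by
      obtain ⟨a, ha, rfl⟩ := hshift _ _ _ hi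
      obtain ⟨b, hb, rfl⟩ := hshift _ _ _ hj
      rw [hL4 a ha, hL4 b hb]
      have : (a : ℚ) < b := by exact_mod_cast (by omega : a < b)
      linarith
  have hD5 : ascentSign (Icc (p + q - k + 1) (p + q - k + k)) L = 1 :=
    ascentSign_eq_one fun i hi j hj hij => by
      obtain ⟨a, ha, rfl⟩ := hshift _ _ _ hi
      obtain ⟨b, hb, rfl⟩ := hshift _ _ _ hj
      rw [hL5 a ha, hL5 b hb]
      exact_mod_cast hii a b (mem_Icc.1 ha).1 (by omega) (mem_Icc.1 hb).2
  have hS1 : Icc 1 p = Icc 1 k ∪ Icc (k + 1) (k + (p - k)) := by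
    ext; simp only [mem_union, mem_Icc]; omega
  have hS2 : Icc (p + 1) (p + q) = Icc (p + 1) (p + (p - k)) ∪
      (Icc (2 * p - k + 1) (2 * p - k + (q - p)) ∪ Icc (p + q - k + 1) (p + q - k + k)) := by
    ext; simp only [mem_union, mem_Icc]; omega
  have hC12 : ∏ i ∈ Icc 1 k, ∏ j ∈ Icc (k + 1) (k + (p - k)), (if L i < L j then (-1 : ℚ) else 1)
      = ∏ b ∈ Icc 1 (p - k), ∏ a ∈ Icc 1 k, if ii a < jj b then (-1 : ℚ) else 1 := by
    rw [prod_comm, prod_Icc_shift rfl rfl]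
    exact prod_congr rfl fun b hb => prod_congr rfl fun a ha => by simp [hL1 a ha, hL2 b hb]
  have hC34 : ∏ i ∈ Icc (p + 1) (p + (p - k)),
      ∏ j ∈ Icc (2 * p - k + 1) (2 * p - k + (q - p)), (if L i < L j then (-1 : ℚ) else 1)
      = (-1) ^ ((p - k) * (q - p)) := by
    have : ∀ b ∈ Icc 1 (p - k), ∏ c ∈ Icc 1 (q - p),
        (if L (p + b) < L (2 * p - k + c) then (-1 : ℚ) else 1) = (-1) ^ (q - p) := by
      intro b hb
      rw [prod_congr rfl (g := fun _ => (-1 : ℚ)), prod_const, Nat.card_Icc, Nat.add_sub_cancel]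
      intro c hc
      rw [hL3 b hb, hL4 c hc, if_pos]
      have h1 : (jj b : ℚ) ≤ p := by exact_mod_cast hjj_le b hb
      have h2 : (c : ℚ) + p ≤ q := by
        have := mem_Icc.1 hc
        exact_mod_cast (by omega : c + p ≤ q)
      linarith
    simp only [prod_Icc_shift rfl rfl]
    rw [prod_congr rfl this, prod_const, Nat.card_Icc, Nat.add_sub_cancel, ← pow_mul, mul_comm]
  have hC35 : ∏ i ∈ Icc (p + 1) (p + (p - k)), ∏ j ∈ Icc (p + q - k + 1) (p + q - k + k),
      (if L i < L j then (-1 : ℚ) else 1)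
      = ∏ b ∈ Icc 1 (p - k), ∏ a ∈ Icc 1 k, if jj b < ii a then (-1 : ℚ) else 1 := by
    simp only [prod_Icc_shift rfl rfl]
    exact prod_congr rfl fun b hb => prod_congr rfl fun a ha => by simp [hL3 b hb, hL5 a ha]
  have hC45 : ∏ i ∈ Icc (2 * p - k + 1) (2 * p - k + (q - p)),
      ∏ j ∈ Icc (p + q - k + 1) (p + q - k + k), (if L i < L j then (-1 : ℚ) else 1) = 1 := by
    simp only [prod_Icc_shift rfl rfl]
    refine prod_eq_one fun c hc => prod_eq_one fun a ha => ?_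
    rw [hL4 c hc, hL5 a ha, if_neg]
    have h1 : (ii a : ℚ) ≤ p := by exact_mod_cast hii_le a ha
    have h2 : (c : ℚ) + p ≤ q := by
      have := mem_Icc.1 hc
      exact_mod_cast (by omega : c + p ≤ q)
    linarith
  have hcross : (∏ b ∈ Icc 1 (p - k), ∏ a ∈ Icc 1 k, if ii a < jj b then (-1 : ℚ) else 1) *
      (∏ b ∈ Icc 1 (p - k), ∏ a ∈ Icc 1 k, if jj b < ii a then (-1 : ℚ) else 1)
      = (-1) ^ ((p - k) * k) := by
    simp only [← prod_mul_distrib]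
    have : ∀ b ∈ Icc 1 (p - k), ∏ a ∈ Icc 1 k, ((if ii a < jj b then (-1 : ℚ) else 1) *
        if jj b < ii a then (-1 : ℚ) else 1) = (-1) ^ k := by
      intro b hb
      rw [prod_congr rfl (g := fun _ => (-1 : ℚ)), prod_const, Nat.card_Icc, Nat.add_sub_cancel]
      intro a ha
      rcases (hne a ha b hb).lt_or_gt with h | h <;> simp [h, h.not_gt]
    rw [prod_congr rfl this, prod_const, Nat.card_Icc, Nat.add_sub_cancel, ← pow_mul, mul_comm]
  have hdisj : Disjoint (Icc (2 * p - k + 1) (2 * p - k + (q - p)))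
      (Icc (p + q - k + 1) (p + q - k + k)) := by
    refine disjoint_left.2 fun x => ?_
    simp only [mem_Icc]
    omega
  rw [PK, hB1, hB2, hS1, hS2, ascentSign_union, ascentSign_union, ascentSign_union]
  · simp only [prod_union hdisj, prod_mul_distrib, hD1, hD2, hD3, hD4, hD5, hC12, hC34, hC35, hC45]
    rw [mul_add, pow_add, ← hcross]
    ring
  all_goals
    intro a ha c hc
    simp only [mem_union, mem_Icc] at ha hc
    omega
end

section
/- Define F : ℚ^n → ℚ by F(λ) = ∑_{A ⊆ Δ_n^+(𝔩)} ∑_{C ⊆ Δ(𝔭_1)} (−1)^{|A|+|C|} P_K(λ − σ(A) − σ(C)). Then for every permutation τ of {1, …, n} that maps each of the blocks B_1, …, B_5 to itself, and every λ ∈ ℚ^n, one has F(λ_{τ(1)}, …, λ_{τ(n)}) = sign(τ) · F(λ). In other words, F is alternating with respect to the group of block-preserving permutations. -/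
open Finset

/-- A permutation of a finite linear order scales the product over pairs `i < j` of an
antisymmetric function by its sign. -/
theorem prod_lt_comp_perm_eq_sign_mul {α R : Type*} [LinearOrder α] [Fintype α] [CommRing R]
    (σ : Equiv.Perm α) {f : α → α → R} (hf : ∀ i j, f i j = -f j i) :
    (∏ i, ∏ j, if i < j then f (σ i) (σ j) else 1) =
      ((Equiv.Perm.sign σ : ℤ) : R) * ∏ i, ∏ j, if i < j then f i j else 1 := by
  let e : Fin (Fintype.card α) ≃o α := Fintype.orderIsoFinOfCardEq α rfl
  have transfer (h : α → α → R) :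
      (∏ i, ∏ j, if i < j then h i j else 1) = ∏ i, ∏ j ∈ Finset.Ioi i, h (e i) (e j) := by
    rw [← e.toEquiv.prod_comp]
    refine Finset.prod_congr rfl fun i _ => ?_
    rw [← e.toEquiv.prod_comp, ← Finset.filter_lt_eq_Ioi, Finset.prod_filter]
    simp
  have key := Equiv.Perm.prod_Ioi_comp_eq_sign_mul_prod (e.toEquiv.symm.permCongr σ)
    (f := fun i j => f (e i) (e j)) fun i j => hf _ _
  rw [transfer, transfer]
  simpa using key

/-- `PK` as a product over all pairs of indices, up to a constant; the factors for pairs meeting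
both blocks are trivial. -/
theorem exists_PK_eq_mul_prod (p q : ℕ) : ∃ c : ℚ, ∀ lam : ℕ → ℚ, PK p q lam =
    c * ∏ i : {t : ℕ // t ∈ Finset.Icc 1 (p + q)}, ∏ j : {t : ℕ // t ∈ Finset.Icc 1 (p + q)},
      if i < j then
        (if (i : ℕ) ≤ p ↔ (j : ℕ) ≤ p then lam i - lam j else if i < j then 1 else -1)
      else 1 := by
  refine ⟨∏ i ∈ Finset.Icc 1 (p + q), ∏ j ∈ Finset.Icc 1 (p + q),
    if i < j ∧ (i ≤ p ↔ j ≤ p) then ((j : ℚ) - i)⁻¹ else 1, fun lam => ?_⟩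
  have h_univ : (∏ i : {t : ℕ // t ∈ Finset.Icc 1 (p + q)},
      ∏ j : {t : ℕ // t ∈ Finset.Icc 1 (p + q)},
      if i < j then
        (if (i : ℕ) ≤ p ↔ (j : ℕ) ≤ p then lam i - lam j else if i < j then 1 else -1)
      else 1) = ∏ i ∈ Finset.Icc 1 (p + q), ∏ j ∈ Finset.Icc 1 (p + q),
        if i < j ∧ (i ≤ p ↔ j ≤ p) then lam i - lam j else 1 := by
    rw [← Finset.prod_coe_sort (Finset.Icc 1 (p + q))]
    refine Finset.prod_congr rfl fun i _ => ?_
    rw [← Finset.prod_coe_sort (Finset.Icc 1 (p + q))]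
    refine Finset.prod_congr rfl fun j _ => ?_
    have : i < j ↔ (i : ℕ) < j := Iff.rfl
    split_ifs <;> first | rfl | tauto
  have h_union : Finset.Icc 1 (p + q) = Finset.Icc 1 p ∪ Finset.Icc (p + 1) (p + q) := by
    ext t
    simp only [Finset.mem_union, Finset.mem_Icc]
    omega
  have h_disj : Disjoint (Finset.Icc 1 p) (Finset.Icc (p + 1) (p + q)) := by
    rw [Finset.disjoint_left]
    intro t
    simp only [Finset.mem_Icc]
    omega
  rw [h_univ, ← Finset.prod_mul_distrib]
  simp_rw [← Finset.prod_mul_distrib]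
  rw [h_union, Finset.prod_union h_disj, PK, blockProd, blockProd]
  congr 1 <;> refine Finset.prod_congr rfl fun i hi => ?_ <;> rw [Finset.prod_union h_disj]
  · rw [Finset.prod_eq_one (s := Finset.Icc (p + 1) (p + q)), mul_one]
    · refine Finset.prod_congr rfl fun j hj => ?_
      have : i ≤ p ↔ j ≤ p := by simp only [Finset.mem_Icc] at hi hj; omega
      simp only [this, and_true, div_eq_inv_mul]
      split_ifs <;> simp
    · intro j hj
      have : ¬(i ≤ p ↔ j ≤ p) := by simp only [Finset.mem_Icc] at hi hj; omega
      simp [this]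
  · rw [Finset.prod_eq_one (s := Finset.Icc 1 p), one_mul]
    · refine Finset.prod_congr rfl fun j hj => ?_
      have : i ≤ p ↔ j ≤ p := by simp only [Finset.mem_Icc] at hi hj; omega
      simp only [this, and_true, div_eq_inv_mul]
      split_ifs <;> simp
    · intro j hj
      have : ¬(i ≤ p ↔ j ≤ p) := by simp only [Finset.mem_Icc] at hi hj; omega
      simp [this]

/-- `PK` is alternating under permutations preserving the two blocks of indices. -/
theorem PK_perm (p q : ℕ) (τ : Equiv.Perm {t : ℕ // t ∈ Finset.Icc (1 : ℕ) (p + q)})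
    (hτ : ∀ t, (τ t : ℕ) ≤ p ↔ (t : ℕ) ≤ p) (lam : ℕ → ℚ) :
    PK p q (fun t => lam (Equiv.Perm.ofSubtype τ t)) =
      ((Equiv.Perm.sign τ : ℤ) : ℚ) * PK p q lam := by
  obtain ⟨c, hc⟩ := exists_PK_eq_mul_prod p q
  rw [hc, hc, mul_left_comm]
  refine Eq.trans ?_ (congrArg (c * ·) (prod_lt_comp_perm_eq_sign_mul τ ?_))
  · congr 1
    refine Finset.prod_congr rfl fun i _ => Finset.prod_congr rfl fun j _ => ?_
    rw [Equiv.Perm.ofSubtype_apply_coe, Equiv.Perm.ofSubtype_apply_coe]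
    by_cases hij : i < j
    · by_cases h : (i : ℕ) ≤ p ↔ (j : ℕ) ≤ p
      · simp [hij, h, hτ]
      · have : τ i < τ j := by
          have hi := hτ i
          have hj := hτ j
          rw [← Subtype.coe_lt_coe] at hij ⊢
          omega
        simp [hij, h, hτ, this]
    · simp [hij]
  · intro i j
    by_cases h : (i : ℕ) ≤ p ↔ (j : ℕ) ≤ p
    · rw [if_pos h, if_pos (Iff.symm h), neg_sub]
    · rw [if_neg h, if_neg fun hji : (j : ℕ) ≤ p ↔ (i : ℕ) ≤ p => h (Iff.symm hji)]
      rcases lt_trichotomy i j with hij | rfl | hij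
      · simp [hij, hij.not_gt]
      · exact absurd Iff.rfl h
      · simp [hij, hij.not_gt]

/-- Permuting the coordinates of `sigmaSum`. -/
theorem sigmaSum_map_prodCongr (g : Equiv.Perm ℕ) (S : Finset (ℕ × ℕ)) (t : ℕ) :
    sigmaSum (S.map (g.prodCongr g).toEmbedding) (g t) = sigmaSum S t := by
  simp only [sigmaSum, root, Finset.sum_map, Equiv.coe_toEmbedding, Equiv.prodCongr_apply,
    Prod.map_fst, Prod.map_snd, g.apply_eq_iff_eq]

/-- Reindexing a sum over the powerset of a finset that is stable under an equivalence. -/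
theorem sum_powerset_map_equiv {α M : Type*} [AddCommMonoid M] (e : Equiv.Perm α)
    {D : Finset α} (hD : ∀ x, e x ∈ D ↔ x ∈ D) (f : Finset α → M) :
    ∑ A ∈ D.powerset, f (A.map e.toEmbedding) = ∑ A ∈ D.powerset, f A := by
  refine Finset.sum_equiv e.finsetCongr (fun A => ?_) fun A _ => rfl
  simp only [Finset.mem_powerset, Finset.subset_iff, Equiv.finsetCongr_apply,
    Finset.mem_map_equiv]
  refine ⟨fun h x hx => ?_, fun h x hx => ?_⟩
  · simpa [hD] using (hD _).2 (h hx)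
  · exact (hD x).1 (h (by simpa using hx))

/-- Define `F(λ) = ∑_{A ⊆ Δ_n^+(𝔩)} ∑_{C ⊆ Δ(𝔭_1)} (−1)^{|A|+|C|} P_K(λ − σ(A) − σ(C))`
(this is `DSum`). For every permutation `τ` of `{1, …, n}` mapping each of the five blocks
`B_1, …, B_5` to itself, and every `λ ∈ ℚ^n`, one has
`F(λ_{τ(1)}, …, λ_{τ(n)}) = sign(τ) · F(λ)`. -/
theorem stmt_10 (p q k : ℕ) (hp : 1 ≤ p) (hpq : p ≤ q) (hk : k ≤ p)
    (τ : Equiv.Perm {t : ℕ // t ∈ Finset.Icc 1 (p + q)})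
    (hblock : ∀ B ∈ [Finset.Icc 1 k, Finset.Icc (k + 1) p, Finset.Icc (p + 1) (2 * p - k),
        Finset.Icc (2 * p - k + 1) (p + q - k), Finset.Icc (p + q - k + 1) (p + q)],
      ∀ t : {t : ℕ // t ∈ Finset.Icc 1 (p + q)}, ((τ t : ℕ) ∈ B ↔ (t : ℕ) ∈ B))
    (lam : ℕ → ℚ) :
    DSum p q k (fun t =>
        if h : t ∈ Finset.Icc 1 (p + q) then lam ((τ ⟨t, h⟩ : ℕ)) else lam t)
      = ((Equiv.Perm.sign τ : ℤ) : ℚ) * DSum p q k lam := by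
  have h_mem : ∀ B ∈ [Finset.Icc 1 k, Finset.Icc (k + 1) p, Finset.Icc (p + 1) (2 * p - k),
      Finset.Icc (2 * p - k + 1) (p + q - k), Finset.Icc (p + q - k + 1) (p + q)],
      ∀ t, Equiv.Perm.ofSubtype τ t ∈ B ↔ t ∈ B := by
    intro B hB t
    by_cases ht : t ∈ Finset.Icc 1 (p + q)
    · rw [Equiv.Perm.ofSubtype_apply_of_mem τ ht]
      exact hblock B hB ⟨t, ht⟩
    · rw [Equiv.Perm.ofSubtype_apply_of_not_mem τ ht]
  have h_le (t : {t : ℕ // t ∈ Finset.Icc 1 (p + q)}) : (τ t : ℕ) ≤ p ↔ (t : ℕ) ≤ p := by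
    have h₁ := hblock (Finset.Icc 1 k) (by simp) t
    have h₂ := hblock (Finset.Icc (k + 1) p) (by simp) t
    have h₃ := t.2
    have h₄ := (τ t).2
    simp only [Finset.mem_Icc] at h₁ h₂ h₃ h₄
    omega
  have h_lam : (fun t => if h : t ∈ Finset.Icc 1 (p + q) then lam ((τ ⟨t, h⟩ : ℕ)) else lam t) =
      fun t => lam (Equiv.Perm.ofSubtype τ t) := by
    funext t
    split_ifs with ht
    · rw [Equiv.Perm.ofSubtype_apply_of_mem τ ht]
    · rw [Equiv.Perm.ofSubtype_apply_of_not_mem τ ht]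
  rw [h_lam]
  generalize hg : Equiv.Perm.ofSubtype τ = g at h_mem
  simp only [List.forall_mem_cons] at h_mem
  obtain ⟨h₁, h₂, h₃, h₄, h₅, -⟩ := h_mem
  have hN (x : ℕ × ℕ) : g.prodCongr g x ∈ DeltaNL p q k ↔ x ∈ DeltaNL p q k := by
    simp only [DeltaNL, Finset.mem_union, Finset.mem_product, Equiv.prodCongr_apply,
      Prod.map_fst, Prod.map_snd, h₁, h₂, h₃, h₅]
  have hP (x : ℕ × ℕ) : g.prodCongr g x ∈ DeltaP1 p q k ↔ x ∈ DeltaP1 p q k := by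
    simp only [DeltaP1, Finset.mem_union, Finset.mem_product, Equiv.prodCongr_apply,
      Prod.map_fst, Prod.map_snd, h₁, h₂, h₄]
  unfold DSum
  rw [← sum_powerset_map_equiv _ hN (fun A => ∑ C ∈ (DeltaP1 p q k).powerset,
    (-1 : ℚ) ^ (A.card + C.card) * PK p q (fun t => lam t - sigmaSum A t - sigmaSum C t)),
    Finset.mul_sum]
  refine Finset.sum_congr rfl fun A _ => ?_
  refine Eq.trans ?_ (congrArg (_ * ·) (sum_powerset_map_equiv _ hP _))
  rw [Finset.mul_sum]
  refine Finset.sum_congr rfl fun C _ => ?_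
  rw [Finset.card_map, Finset.card_map, mul_left_comm, ← PK_perm p q τ h_le, hg]
  simp only [sigmaSum_map_prodCongr]
end

section
/- Let 1 ≤ p ≤ q, n = p + q, and let V = ∏_{1≤i<j≤p} (x_i − x_j) · ∏_{p+1≤i<j≤n} (x_i − x_j) ∈ ℂ[x_1, …, x_n]. Let M be the ℂ-linear span of the orbit {σ · V : σ ∈ S_n} of V under the action of the symmetric group S_n. Then M is an irreducible S_n-module: the only ℂ-subspaces of M stable under the action of every σ ∈ S_n are {0} and M. (This is the irreducibility of the Weyl-group representation generated by the Weyl dimension polynomial P_K, in the case G_ℝ = SU(p,q).) -/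
open MvPolynomial

/-- The polynomial `V = ∏_{1≤i<j≤p} (x_i − x_j) · ∏_{p+1≤i<j≤p+q} (x_i − x_j)`
in `ℂ[x_1, …, x_n]`, `n = p + q` (variables indexed by `Fin (p+q)`, where index `i : Fin (p+q)`
corresponds to the classical index `i+1`). -/
noncomputable def Vsu (p q : ℕ) : MvPolynomial (Fin (p + q)) ℂ :=
  ∏ pr ∈ Finset.univ.filter (fun pr : Fin (p + q) × Fin (p + q) =>
      pr.1 < pr.2 ∧ (((pr.1 : ℕ) < p ∧ (pr.2 : ℕ) < p) ∨ (p ≤ (pr.1 : ℕ) ∧ p ≤ (pr.2 : ℕ)))),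
    (MvPolynomial.X pr.1 - MvPolynomial.X pr.2)

/-- The action of `S_n` on `ℂ[x_1, …, x_n]`: `(σ · f)(x_1, …, x_n) = f(x_{σ⁻¹(1)}, …, x_{σ⁻¹(n)})`,
i.e. the variable substitution `x_i ↦ x_{σ⁻¹(i)}`. -/
noncomputable def permAct {n : ℕ} (σ : Equiv.Perm (Fin n)) (f : MvPolynomial (Fin n) ℂ) :
    MvPolynomial (Fin n) ℂ :=
  MvPolynomial.rename (⇑σ⁻¹) f

open Equiv

section Auxiliary

variable {ι : Type*}

/-- `X i - X j` generates the kernel of the substitution `X i ↦ X j`. -/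
lemma X_sub_X_dvd_iff [DecidableEq ι] (i j : ι) (f : MvPolynomial ι ℂ) :
    (X i - X j : MvPolynomial ι ℂ) ∣ f ↔ rename (Function.update id i j) f = 0 := by
  constructor
  · rintro ⟨g, rfl⟩
    have : Function.update id i j j = j := by
      by_cases h : j = i
      · subst h; simp
      · simp [h]
    simp [this]
  · intro h
    suffices H : (X i - X j : MvPolynomial ι ℂ) ∣ f - rename (Function.update id i j) f by
      simpa [h] using H
    clear h
    induction f using MvPolynomial.induction_on with
    | C a => simp
    | add f g hf hg =>
      rw [map_add, add_sub_add_comm]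
      exact dvd_add hf hg
    | mul_X f k hf =>
      have hk : (X i - X j : MvPolynomial ι ℂ) ∣ X k - X (Function.update id i j k) := by
        by_cases h : k = i
        · subst h; simp
        · simp [h]
      rw [map_mul, rename_X, show ∀ a b c e : MvPolynomial ι ℂ, a * b - c * e = (a - c) * b + c * (b - e) by intros; ring]
      exact dvd_add (hf.mul_right _) (hk.mul_left _)

lemma prime_X_sub_X {i j : ι} (h : i ≠ j) : Prime (X i - X j : MvPolynomial ι ℂ) := by
  classical
  refine ⟨?_, ?_, ?_⟩
  · rw [sub_ne_zero]
    exact fun e => h (X_injective e)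
  · rw [isUnit_iff_dvd_one, X_sub_X_dvd_iff]
    simp
  · intro a b hab
    simpa [X_sub_X_dvd_iff] using hab

/-- An alternating polynomial for a transposition is divisible by the corresponding difference. -/
lemma X_sub_X_dvd_of_swap [DecidableEq ι] (i j : ι) (f : MvPolynomial ι ℂ)
    (hf : rename (swap i j) f = -f) : (X i - X j : MvPolynomial ι ℂ) ∣ f := by
  rw [X_sub_X_dvd_iff]
  have h := congrArg (rename (Function.update id i j)) hf
  have hc : Function.update id i j ∘ swap i j = Function.update id i j := by
    funext k
    by_cases h1 : k = i
    · subst h1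
      by_cases h2 : j = k <;> simp [h2]
    · by_cases h2 : k = j
      · subst h2; simp [h1]
      · simp [swap_apply_of_ne_of_ne h1 h2]
  rw [rename_rename, hc, map_neg] at h
  exact self_eq_neg.mp h

variable [Fintype ι] [DecidableEq ι]

/-- The antisymmetrizer of a subgroup of permutations, acting on polynomials. -/
noncomputable def antisymmetrizer (H : Subgroup (Perm ι)) [Fintype H] :
    MvPolynomial ι ℂ →ₗ[ℂ] MvPolynomial ι ℂ :=
  ∑ σ : H, ((Perm.sign (σ : Perm ι) : ℤ) : ℂ) • (rename (σ : Perm ι)).toLinearMap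

lemma antisymmetrizer_apply (H : Subgroup (Perm ι)) [Fintype H] (f : MvPolynomial ι ℂ) :
    antisymmetrizer H f =
      ∑ σ : H, ((Perm.sign (σ : Perm ι) : ℤ) : ℂ) • rename (σ : Perm ι) f := by
  simp [antisymmetrizer]

lemma sign_mul_self_complex (σ : Perm ι) :
    ((Perm.sign σ : ℤ) : ℂ) * ((Perm.sign σ : ℤ) : ℂ) = 1 := by
  rcases Int.units_eq_one_or (Perm.sign σ) with h | h <;> simp [h]

lemma rename_antisymmetrizer (H : Subgroup (Perm ι)) [Fintype H] (τ : H) (f : MvPolynomial ι ℂ) :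
    rename (τ : Perm ι) (antisymmetrizer H f) =
      ((Perm.sign (τ : Perm ι) : ℤ) : ℂ) • antisymmetrizer H f := by
  rw [antisymmetrizer_apply, map_sum, Finset.smul_sum,
    ← Equiv.sum_comp (Equiv.mulLeft τ) (fun σ : H =>
      ((Perm.sign (τ : Perm ι) : ℤ) : ℂ) • ((Perm.sign (σ : Perm ι) : ℤ) : ℂ) •
        rename (σ : Perm ι) f)]
  refine Finset.sum_congr rfl fun σ _ => ?_
  rw [map_smul, rename_rename, smul_smul]
  simp [← mul_assoc, sign_mul_self_complex, Perm.coe_mul]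

/-- The coefficientwise Hermitian pairing of the degree `d` parts of two polynomials. -/
noncomputable def coeffPairing (d : ℕ) (g : MvPolynomial ι ℂ) : MvPolynomial ι ℂ →ₗ[ℂ] ℂ :=
  ∑ m ∈ Finset.univ.finsuppAntidiag d, (starRingEnd ℂ (coeff m g)) • lcoeff ℂ m

lemma coeffPairing_apply (d : ℕ) (g f : MvPolynomial ι ℂ) :
    coeffPairing d g f =
      ∑ m ∈ Finset.univ.finsuppAntidiag d, starRingEnd ℂ (coeff m g) * coeff m f := by
  simp [coeffPairing]

lemma coeffPairing_swap (d : ℕ) (g f : MvPolynomial ι ℂ) :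
    coeffPairing d g f = starRingEnd ℂ (coeffPairing d f g) := by
  simp [coeffPairing_apply, mul_comm]

lemma coeffPairing_rename (d : ℕ) (σ : Perm ι) (g f : MvPolynomial ι ℂ) :
    coeffPairing d (rename σ g) (rename σ f) = coeffPairing d g f := by
  rw [coeffPairing_apply, coeffPairing_apply]
  symm
  refine Finset.sum_equiv (Finsupp.domCongr σ).toEquiv (fun m => ?_) (fun m _ => ?_)
  · have : Finset.univ.sum (Finsupp.equivMapDomain σ m) = Finset.univ.sum m :=
      Equiv.sum_comp σ.symm (fun i => m i)
    simp [Finset.mem_finsuppAntidiag, this]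
  · have : (Finsupp.domCongr σ).toEquiv m = m.mapDomain σ := by
      simp [Finsupp.equivMapDomain_eq_mapDomain]
    rw [this, coeff_rename_mapDomain _ σ.injective, coeff_rename_mapDomain _ σ.injective]

lemma eq_zero_of_coeffPairing_self {d : ℕ} {f : MvPolynomial ι ℂ} (hf : f.IsHomogeneous d)
    (h : coeffPairing d f f = 0) : f = 0 := by
  have h' : ∑ m ∈ Finset.univ.finsuppAntidiag d, Complex.normSq (coeff m f) = 0 := by
    rw [coeffPairing_apply] at h
    simp_rw [← Complex.normSq_eq_conj_mul_self] at h
    exact_mod_cast h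
  rw [Finset.sum_eq_zero_iff_of_nonneg fun _ _ => Complex.normSq_nonneg _] at h'
  ext m
  by_cases hm : m.degree = d
  · simpa using h' m (by
      simpa [Finset.mem_finsuppAntidiag, Finsupp.degree_eq_sum] using hm)
  · simpa using hf.coeff_eq_zero hm

/-- A homogeneous `V` that alternates under `H` is orthogonal to every polynomial killed by the
antisymmetrizer of `H`. -/
lemma coeffPairing_antisymmetrizer (d : ℕ) (H : Subgroup (Perm ι)) [Fintype H]
    {V : MvPolynomial ι ℂ}
    (hV : ∀ σ ∈ H, rename σ V = ((Perm.sign σ : ℤ) : ℂ) • V) (f : MvPolynomial ι ℂ) :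
    coeffPairing d V (antisymmetrizer H f) = Fintype.card H * coeffPairing d V f := by
  rw [antisymmetrizer_apply, map_sum]
  have key (σ : H) : coeffPairing d V (((Perm.sign (σ : Perm ι) : ℤ) : ℂ) •
      rename (σ : Perm ι) f) = coeffPairing d V f := by
    rw [← coeffPairing_rename d (σ : Perm ι) V f, hV σ σ.2, map_smul, coeffPairing_swap,
      coeffPairing_swap d (_ • V), map_smul]
    simp
  simp [key]

end Auxiliary

/-- The permutations preserving the block `{i | i < p}` and its complement. -/
def blockSubgroup (p q : ℕ) : Subgroup (Perm (Fin (p + q))) where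
  carrier := {σ | ∀ i, ((σ i : ℕ) < p ↔ (i : ℕ) < p)}
  one_mem' := by simp
  mul_mem' := by
    intro σ τ hσ hτ i
    rw [Perm.mul_apply, hσ, hτ]
  inv_mem' := by
    intro σ hσ i
    simpa using (hσ (σ⁻¹ i)).symm

lemma mem_blockSubgroup {p q : ℕ} {σ : Perm (Fin (p + q))} :
    σ ∈ blockSubgroup p q ↔ ∀ i, ((σ i : ℕ) < p ↔ (i : ℕ) < p) := Iff.rfl

lemma swap_mem_blockSubgroup {p q : ℕ} {i j : Fin (p + q)} (h : (i : ℕ) < p ↔ (j : ℕ) < p) :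
    swap i j ∈ blockSubgroup p q := by
  intro k
  rw [swap_apply_def]
  split_ifs with h1 h2
  · rw [h1, h]
  · rw [h2, h]
  · rfl

lemma rename_Vsu {p q : ℕ} {σ : Perm (Fin (p + q))} (hσ : σ ∈ blockSubgroup p q) :
    rename σ (Vsu p q) = ((Perm.sign σ : ℤ) : ℂ) • Vsu p q := by
  -- cross-block pairs contribute a sign, so that the product runs over all pairs
  let F (i j : Fin (p + q)) : MvPolynomial (Fin (p + q)) ℂ :=
    if ((i : ℕ) < p ↔ (j : ℕ) < p) then X i - X j else if (i : ℕ) < p then 1 else -1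
  have hF : ∀ i j, F i j = -F j i := by
    intro i j
    by_cases hi : (i : ℕ) < p <;> by_cases hj : (j : ℕ) < p <;> simp [F, hi, hj]
  have hV : Vsu p q = ∏ i, ∏ j ∈ Finset.Ioi i, F i j := by
    rw [Finset.prod_sigma', Vsu]
    symm
    have : ∀ x : (_ : Fin (p + q)) × Fin (p + q), x ∈ Finset.univ.sigma (fun i => Finset.Ioi i) →
        F x.1 x.2 = if (((x.1 : ℕ) < p ∧ (x.2 : ℕ) < p) ∨ (p ≤ (x.1 : ℕ) ∧ p ≤ (x.2 : ℕ)))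
          then X x.1 - X x.2 else 1 := by
      rintro ⟨i, j⟩ hij
      have hij : i < j := by simpa using hij
      have hij : (i : ℕ) < j := hij
      simp only [F]
      split_ifs <;> first | rfl | omega
    rw [Finset.prod_congr rfl this, ← Finset.prod_filter]
    refine Finset.prod_bij' (fun x _ => (x.1, x.2)) (fun x _ => ⟨x.1, x.2⟩) ?_ ?_ ?_ ?_ ?_ <;>
      simp
  have hσF : ∀ i j, rename σ (F i j) = F (σ i) (σ j) := by
    intro i j
    simp only [F, mem_blockSubgroup.1 hσ]
    split_ifs <;> simp
  rw [hV, map_prod]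
  simp_rw [map_prod, hσF]
  rw [Perm.prod_Ioi_comp_eq_sign_mul_prod σ hF, smul_eq_C_mul]
  simp

lemma Vsu_isHomogeneous (p q : ℕ) : ∃ d, (Vsu p q).IsHomogeneous d :=
  ⟨_, IsHomogeneous.prod _ _ _ fun _ _ => (isHomogeneous_X ℂ _).sub (isHomogeneous_X ℂ _)⟩

lemma Vsu_ne_zero (p q : ℕ) : Vsu p q ≠ 0 := by
  refine Finset.prod_ne_zero_iff.2 fun x hx => (prime_X_sub_X ?_).ne_zero
  exact (Finset.mem_filter.1 hx).2.1.ne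

lemma Vsu_dvd {p q : ℕ} {f : MvPolynomial (Fin (p + q)) ℂ}
    (hf : ∀ σ ∈ blockSubgroup p q, rename σ f = ((Perm.sign σ : ℤ) : ℂ) • f) : Vsu p q ∣ f := by
  refine Finset.prod_dvd_of_isRelPrime ?_ ?_
  · rintro ⟨i, j⟩ hx ⟨k, l⟩ hy hne
    have hij : i < j := (Finset.mem_filter.1 hx).2.1
    have hkl : k < l := (Finset.mem_filter.1 hy).2.1
    change IsRelPrime (X i - X j) (X k - X l)
    rw [(prime_X_sub_X hij.ne).irreducible.isRelPrime_iff_not_dvd, X_sub_X_dvd_iff]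
    intro h
    rw [map_sub, rename_X, rename_X, sub_eq_zero] at h
    have h := X_injective h
    simp only [Function.update_apply, id] at h
    apply hne
    split_ifs at h <;> grind
  · rintro ⟨i, j⟩ hx
    obtain ⟨hij, hb⟩ := (Finset.mem_filter.1 hx).2
    refine X_sub_X_dvd_of_swap i j f ?_
    rw [hf _ (swap_mem_blockSubgroup (by dsimp at hb; omega)), Perm.sign_swap hij.ne]
    simp

lemma eq_smul_of_dvd_of_isHomogeneous {ι : Type*} {d : ℕ} {V f : MvPolynomial ι ℂ}
    (hV : V.IsHomogeneous d) (hf : f.IsHomogeneous d) (h : V ∣ f) : ∃ c : ℂ, f = c • V := by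
  obtain ⟨g, rfl⟩ := h
  by_cases h0 : V * g = 0
  · exact ⟨0, by simp [h0]⟩
  · have hV0 := left_ne_zero_of_mul h0
    have hg0 := right_ne_zero_of_mul h0
    have h1 := hf.totalDegree h0
    rw [totalDegree_mul_of_isDomain hV0 hg0, hV.totalDegree hV0] at h1
    have h2 := totalDegree_eq_zero_iff_eq_C.1 (show g.totalDegree = 0 by omega)
    refine ⟨g.coeff 0, ?_⟩
    rw [smul_eq_C_mul, ← h2, mul_comm]

/-- Let `1 ≤ p ≤ q`, `n = p + q`, and let `M` be the `ℂ`-linear span of the `S_n`-orbit of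
`V = ∏_{1≤i<j≤p}(x_i−x_j) · ∏_{p+1≤i<j≤n}(x_i−x_j)`. Then `M` is an irreducible `S_n`-module:
the only `ℂ`-subspaces of `M` stable under every `σ ∈ S_n` are `{0}` and `M`. -/
theorem stmt_17 (p q : ℕ) (hp : 1 ≤ p) (hpq : p ≤ q) :
    ∀ N : Submodule ℂ (MvPolynomial (Fin (p + q)) ℂ),
      N ≤ Submodule.span ℂ (Set.range fun σ : Equiv.Perm (Fin (p + q)) => permAct σ (Vsu p q)) →
      (∀ σ : Equiv.Perm (Fin (p + q)), ∀ f ∈ N, permAct σ f ∈ N) →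
      N = ⊥ ∨
        N = Submodule.span ℂ
          (Set.range fun σ : Equiv.Perm (Fin (p + q)) => permAct σ (Vsu p q)) := by
  classical
  intro N hNM hN
  obtain ⟨d, hd⟩ := Vsu_isHomogeneous p q
  have hNr (σ : Perm (Fin (p + q))) (f) (hf : f ∈ N) : rename σ f ∈ N := by
    simpa [permAct] using hN σ⁻¹ f hf
  have hhom : ∀ f ∈ N, f.IsHomogeneous d := by
    intro f hf
    suffices Submodule.span ℂ (Set.range fun σ : Perm (Fin (p + q)) => permAct σ (Vsu p q)) ≤
      homogeneousSubmodule (Fin (p + q)) ℂ d from this (hNM hf)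
    rw [Submodule.span_le]
    rintro _ ⟨σ, rfl⟩
    exact hd.rename_isHomogeneous
  have hAN : ∀ f ∈ N, antisymmetrizer (blockSubgroup p q) f ∈ N := by
    intro f hf
    rw [antisymmetrizer_apply]
    exact N.sum_mem fun σ _ => N.smul_mem _ (hNr _ _ hf)
  by_cases hVN : Vsu p q ∈ N
  · right
    refine le_antisymm hNM ?_
    rw [Submodule.span_le]
    rintro _ ⟨σ, rfl⟩
    exact hN σ _ hVN
  · left
    have hA : ∀ f ∈ N, antisymmetrizer (blockSubgroup p q) f = 0 := by
      intro f hf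
      obtain ⟨c, hc⟩ := eq_smul_of_dvd_of_isHomogeneous hd (hhom _ (hAN f hf))
        (Vsu_dvd fun σ hσ => rename_antisymmetrizer _ ⟨σ, hσ⟩ f)
      rw [hc]
      by_contra h
      refine hVN ((N.smul_mem_iff (left_ne_zero_of_smul h)).1 ?_)
      rw [← hc]
      exact hAN f hf
    have hperp : ∀ f ∈ N, coeffPairing d (Vsu p q) f = 0 := by
      intro f hf
      have h := coeffPairing_antisymmetrizer d (blockSubgroup p q) (fun σ hσ => rename_Vsu hσ) f
      rw [hA f hf, map_zero] at h
      simpa using h.symm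
    rw [Submodule.eq_bot_iff]
    intro f hf
    refine eq_zero_of_coeffPairing_self (hhom f hf) ?_
    suffices Submodule.span ℂ (Set.range fun σ : Perm (Fin (p + q)) => permAct σ (Vsu p q)) ≤
      LinearMap.ker (coeffPairing d f) from this (hNM hf)
    rw [Submodule.span_le]
    rintro _ ⟨σ, rfl⟩
    have h : f = rename ⇑σ⁻¹ (rename σ f) := by
      rw [rename_rename, ← Perm.coe_mul]
      simp
    change coeffPairing d f (rename ⇑σ⁻¹ (Vsu p q)) = 0
    rw [h, coeffPairing_rename, coeffPairing_swap, hperp _ (hNr σ f hf), map_zero]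
end
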